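/- arXiv:0708.0669 — 7 statements merged into one kernel-verified Lean document; each statement's English description precedes it below -/
import Mathlib

section
/- For every Lagrangian subspace L ⊂ V, the representation (π_L, 𝓗_L) of the Heisenberg group H is irreducible: the only H-invariant subspaces of 𝓗_L are 0 and 𝓗_L. -/
namespace Stmt3

/-- Heisenberg multiplication on `V × F`: `(v,z)·(v',z') = (v+v', z+z'+½ω(v,v'))`. -/
def hmul {F V : Type} [Field F] [AddCommGroup V] [Module F V]
    (ω : V →ₗ[F] V →ₗ[F] F) (a b : V × F) : V × F :=
  (a.1 + b.1, a.2 + b.2 + (2 : F)⁻¹ * ω a.1 b.1)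

/-- A Lagrangian subspace: `n`-dimensional and `ω` vanishes identically on it. -/
def IsLagrangian {F V : Type} [Field F] [AddCommGroup V] [Module F V]
    (n : ℕ) (ω : V →ₗ[F] V →ₗ[F] F) (L : Submodule F V) : Prop :=
  Module.finrank F L = n ∧ ∀ x ∈ L, ∀ y ∈ L, ω x y = 0

/-- Right translation `(π(h)f)(h') = f(h'·h)`. -/
def rt {F V : Type} [Field F] [AddCommGroup V] [Module F V]
    (ω : V →ₗ[F] V →ₗ[F] F) (h : V × F) (f : (V × F) → ℂ) : (V × F) → ℂ :=
  fun h' => f (hmul ω h' h)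

/-- The model `𝓗_L = {f : H → ℂ | f((l,z)·h) = ψ(z)·f(h) for l ∈ L, z ∈ F}`,
as a complex subspace of the space of functions on the Heisenberg group. -/
noncomputable def HeisModel {F V : Type} [Field F] [AddCommGroup V] [Module F V]
    (ω : V →ₗ[F] V →ₗ[F] F) (ψ : F → ℂ) (L : Submodule F V) :
    Submodule ℂ ((V × F) → ℂ) where
  carrier := {f | ∀ l ∈ L, ∀ (z : F) (h : V × F), f (hmul ω (l, z) h) = ψ z * f h}
  add_mem' := by
    intro f g hf hg l hl z h
    simp only [Pi.add_apply, hf l hl z h, hg l hl z h, mul_add]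
  zero_mem' := by
    intro l hl z h
    simp
  smul_mem' := by
    intro c f hf l hl z h
    simp only [Pi.smul_apply, hf l hl z h, smul_eq_mul]
    ring

/-- A Lagrangian subspace contains every vector orthogonal to it. -/
lemma mem_of_orth {F V : Type} [Field F] [AddCommGroup V] [Module F V] [FiniteDimensional F V]
    (n : ℕ) (ω : V →ₗ[F] V →ₗ[F] F) (halt : ∀ v : V, ω v v = 0)
    (hnd : ∀ v : V, (∀ w : V, ω v w = 0) → v = 0)
    (hdim : Module.finrank F V = 2 * n)
    (L : Submodule F V) (hL : IsLagrangian n ω L) (v : V) (hv : ∀ l ∈ L, ω v l = 0) :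
    v ∈ L := by
  have hA : LinearMap.IsAlt ω := halt
  have hR : LinearMap.IsRefl ω := hA.isRefl
  have hN : LinearMap.BilinForm.Nondegenerate ω :=
    hR.nondegenerate_iff_separatingLeft.2 hnd
  have hle : L ≤ LinearMap.BilinForm.orthogonal ω L := by
    intro x hx y hy
    exact hL.2 y hy x hx
  have hfr := LinearMap.BilinForm.finrank_orthogonal hN L
  have heq : L = LinearMap.BilinForm.orthogonal ω L := by
    apply Submodule.eq_of_le_of_finrank_eq hle
    rw [hfr, hdim, hL.1]
    omega
  rw [heq]
  intro y hy
  exact hR _ _ (hv y hy)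

/-- Orthogonality of characters along a Lagrangian subspace. -/
lemma sum_char {F V : Type} [Field F] [AddCommGroup V] [Module F V]
    (ω : V →ₗ[F] V →ₗ[F] F)
    (ψ : F → ℂ) (hψadd : ∀ a b : F, ψ (a + b) = ψ a * ψ b)
    (hψnt : ∃ a : F, ψ a ≠ 1)
    (L : Submodule F V) [Fintype L] (v : V) (hv : ∃ l ∈ L, ω v l ≠ 0) :
    ∑ l : L, ψ (ω v l) = 0 := by
  obtain ⟨a, ha⟩ := hψnt
  obtain ⟨l, hl, hne⟩ := hv
  let m : L := ⟨(a / ω v l) • l, L.smul_mem _ hl⟩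
  have hm : ω v (m : V) = a := by
    simp [m, hne]
  have h1 : ∑ l : L, ψ (ω v l) = ψ a * ∑ l : L, ψ (ω v l) := by
    rw [Finset.mul_sum, ← Equiv.sum_comp (Equiv.addLeft m)]
    refine Finset.sum_congr rfl fun x _ => ?_
    rw [← hψadd, ← hm]
    simp
  have h2 : (ψ a - 1) * ∑ l : L, ψ (ω v l) = 0 := by linear_combination -h1
  exact (mul_eq_zero.1 h2).resolve_left (sub_ne_zero.2 ha)

/-- the model `(π_L, 𝓗_L)` of the Heisenberg group is irreducible: its only
invariant subspaces are `0` and `𝓗_L`. -/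
theorem stmt_3 (n : ℕ) (F V : Type) [Field F] [Fintype F]
    (hq : Odd (Fintype.card F)) [AddCommGroup V] [Module F V] [Fintype V]
    (ω : V →ₗ[F] V →ₗ[F] F)
    (halt : ∀ v : V, ω v v = 0)
    (hnd : ∀ v : V, (∀ w : V, ω v w = 0) → v = 0)
    (hdim : Module.finrank F V = 2 * n)
    (ψ : F → ℂ) (hψadd : ∀ a b : F, ψ (a + b) = ψ a * ψ b) (hψ0 : ψ 0 = 1)
    (hψnt : ∃ a : F, ψ a ≠ 1)
    (L : Submodule F V) (hL : IsLagrangian n ω L) :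
    ∀ W : Submodule ℂ ((V × F) → ℂ), W ≤ HeisModel ω ψ L →
      (∀ h : V × F, ∀ f ∈ W, rt ω h f ∈ W) →
      W = ⊥ ∨ W = HeisModel ω ψ L := by
  classical
  intro W hW hinv
  have h2 : (2 : F) ≠ 0 := by
    intro h
    have hc : ringChar F ≠ 2 := fun hc => by
      have h3 := FiniteField.even_card_iff_char_two.1 hc
      have h4 := Nat.odd_iff.1 hq
      omega
    exact Ring.two_ne_zero hc h
  have hskew : ∀ x y, ω x y = - ω y x := fun x y => by
    have hA : LinearMap.IsAlt ω := halt
    exact (hA.neg y x).symm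
  by_cases hbot : W = ⊥
  · exact Or.inl hbot
  right
  apply le_antisymm hW
  obtain ⟨f, hfW, hf0⟩ := W.ne_bot_iff.1 hbot
  obtain ⟨h0, hh0⟩ := Function.ne_iff.1 hf0
  set g := rt ω h0 f with hg
  have hgW : g ∈ W := hinv h0 f hfW
  have hg0 : g (0, 0) ≠ 0 := by
    simpa [hg, rt, hmul] using hh0
  have hgM := hW hgW
  -- the averaged function
  set d : (V × F) → ℂ := ∑ l : L, rt ω ((l : V), 0) g with hd
  have hdW : d ∈ W := W.sum_mem fun l _ => hinv _ _ hgW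
  have hdv : ∀ v z, d (v, z) = (∑ l : L, ψ (ω v l)) * g (v, z) := by
    intro v z
    rw [hd, Finset.sum_apply, Finset.sum_mul]
    refine Finset.sum_congr rfl fun l _ => ?_
    rw [← hgM l l.2 (ω v l) (v, z)]
    simp only [rt, hmul]
    congr 1
    ext
    · simp [add_comm]
    · simp only [hskew (l : V) v]
      field_simp
      ring
  have hdout : ∀ v z, v ∉ L → d (v, z) = 0 := by
    intro v z hv
    rw [hdv, sum_char ω ψ hψadd hψnt L v, zero_mul]
    by_contra! hcon
    exact hv (mem_of_orth n ω halt hnd hdim L hL v hcon)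
  have hdin : ∀ v z, v ∈ L → d (v, z) = (Fintype.card L : ℂ) * (ψ z * g (0, 0)) := by
    intro v z hv
    rw [hdv, ← hgM v hv z (0, 0)]
    have : ∀ l : L, ψ (ω v l) = 1 := fun l => by rw [hL.2 v hv l l.2, hψ0]
    simp [this, hmul]
  have hcard : (Fintype.card L : ℂ) ≠ 0 := by
    exact_mod_cast Fintype.card_ne_zero
  intro φ hφ
  have key : ∑ w : V, φ (w, 0) • rt ω (-w, 0) d
      = ((Fintype.card L : ℂ) * ((Fintype.card L : ℂ) * g (0, 0))) • φ := by
    ext ⟨v, z⟩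
    rw [Finset.sum_apply, ← Equiv.sum_comp (Equiv.subLeft v)]
    have hterm : ∀ l : V, (φ (Equiv.subLeft v l, 0) • rt ω (-(Equiv.subLeft v l), 0) d) (v, z)
        = if l ∈ L then (Fintype.card L : ℂ) * g (0, 0) * φ (v, z) else 0 := by
      intro l
      have e1 : hmul ω (v, z) (-(v - l), 0) = (l, z + (2 : F)⁻¹ * ω v l) := by
        simp [hmul, halt]
      simp only [Pi.smul_apply, rt, Equiv.subLeft_apply, e1, smul_eq_mul]
      split_ifs with hl
      · rw [hdin _ _ hl]
        have e2 := hφ l hl (z + (2 : F)⁻¹ * ω v l) (v - l, 0)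
        have e3 : hmul ω (l, z + (2 : F)⁻¹ * ω v l) (v - l, 0) = (v, z) := by
          simp [hmul, halt, hskew l v]
        rw [e3] at e2
        rw [e2]
        ring
      · rw [hdout _ _ hl, mul_zero]
    rw [Finset.sum_congr rfl fun l _ => hterm l, ← Finset.sum_filter, Finset.sum_const]
    have : (Finset.univ.filter fun l => l ∈ L).card = Fintype.card L :=
      (Fintype.card_subtype _).symm
    rw [this]
    simp
    ring
  have hmem : ((Fintype.card L : ℂ) * ((Fintype.card L : ℂ) * g (0, 0))) • φ ∈ W := by
    rw [← key]
    exact W.sum_mem fun w _ => W.smul_mem _ (hinv _ _ hdW)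
  exact (W.smul_mem_iff (mul_ne_zero hcard (mul_ne_zero hcard hg0))).1 hmem

end Stmt3
end

section
/- (Stone–von Neumann theorem.) Let (π, 𝓗) be any irreducible complex representation of the Heisenberg group H on a finite-dimensional complex vector space such that π((0,z)) = ψ(z)·Id for all z ∈ 𝔽_q. Then for every Lagrangian subspace L ⊂ V, (π, 𝓗) is isomorphic as an H-representation to the model (π_L, 𝓗_L). In particular, any two irreducible representations of H with central character ψ are isomorphic. -/
namespace Stmt4

/-- Heisenberg multiplication on `V × F`: `(v,z)·(v',z') = (v+v', z+z'+½ω(v,v'))`. -/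
def hmul {F V : Type} [Field F] [AddCommGroup V] [Module F V]
    (ω : V →ₗ[F] V →ₗ[F] F) (a b : V × F) : V × F :=
  (a.1 + b.1, a.2 + b.2 + (2 : F)⁻¹ * ω a.1 b.1)

/-- A Lagrangian subspace: `n`-dimensional and `ω` vanishes identically on it. -/
def IsLagrangian {F V : Type} [Field F] [AddCommGroup V] [Module F V]
    (n : ℕ) (ω : V →ₗ[F] V →ₗ[F] F) (L : Submodule F V) : Prop :=
  Module.finrank F L = n ∧ ∀ x ∈ L, ∀ y ∈ L, ω x y = 0

/-- Right translation `(π(h)f)(h') = f(h'·h)`. -/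
def rt {F V : Type} [Field F] [AddCommGroup V] [Module F V]
    (ω : V →ₗ[F] V →ₗ[F] F) (h : V × F) (f : (V × F) → ℂ) : (V × F) → ℂ :=
  fun h' => f (hmul ω h' h)

/-- The model `𝓗_L = {f : H → ℂ | f((l,z)·h) = ψ(z)·f(h) for l ∈ L, z ∈ F}`,
as a complex subspace of the space of functions on the Heisenberg group. -/
noncomputable def HeisModel {F V : Type} [Field F] [AddCommGroup V] [Module F V]
    (ω : V →ₗ[F] V →ₗ[F] F) (ψ : F → ℂ) (L : Submodule F V) :
    Submodule ℂ ((V × F) → ℂ) where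
  carrier := {f | ∀ l ∈ L, ∀ (z : F) (h : V × F), f (hmul ω (l, z) h) = ψ z * f h}
  add_mem' := by
    intro f g hf hg l hl z h
    simp only [Pi.add_apply, hf l hl z h, hg l hl z h, mul_add]
  zero_mem' := by
    intro l hl z h
    simp
  smul_mem' := by
    intro c f hf l hl z h
    simp only [Pi.smul_apply, hf l hl z h, smul_eq_mul]
    ring

theorem charsum {F A : Type} [Field F] [AddCommGroup A] [Module F A] [Fintype A]
    (ψ : F → ℂ) (hψadd : ∀ a b : F, ψ (a + b) = ψ a * ψ b) (hψnt : ∃ a : F, ψ a ≠ 1)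
    (φ : A →ₗ[F] F) (x : A) (hx : φ x ≠ 0) : ∑ a, ψ (φ a) = 0 := by
  obtain ⟨t, ht⟩ := hψnt
  have h1 : φ ((t / φ x) • x) = t := by
    rw [map_smul, smul_eq_mul, div_mul_cancel₀ _ hx]
  have h2 : ∑ a, ψ (φ (a + (t / φ x) • x)) = ∑ a, ψ (φ a) :=
    Fintype.sum_equiv (Equiv.addRight ((t / φ x) • x)) _ _ (fun a => rfl)
  simp only [map_add φ, h1, hψadd, ← Finset.sum_mul] at h2
  have h3 : (∑ a, ψ (φ a)) * (ψ t - 1) = 0 := by rw [mul_sub, h2]; ring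
  rcases mul_eq_zero.1 h3 with h | h
  · exact h
  · exact absurd (sub_eq_zero.1 h) ht

theorem lag_perp {F V : Type} [Field F] [AddCommGroup V] [Module F V] [Finite V]
    (n : ℕ) (ω : V →ₗ[F] V →ₗ[F] F)
    (halt : ∀ v : V, ω v v = 0)
    (hnd : ∀ v : V, (∀ w : V, ω v w = 0) → v = 0)
    (hdim : Module.finrank F V = 2 * n)
    (L : Submodule F V) (hL : IsLagrangian n ω L) (v : V) (hv : ∀ l ∈ L, ω v l = 0) : v ∈ L := by
  have halt' : LinearMap.IsAlt ω := halt
  have : FiniteDimensional F V := Module.Finite.of_finite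
  have hr : LinearMap.BilinForm.IsRefl ω := halt'.isRefl
  have hn : LinearMap.BilinForm.Nondegenerate ω :=
    hr.nondegenerate_iff_separatingLeft.2 hnd
  have hf := LinearMap.BilinForm.finrank_orthogonal hn L
  have hle : L ≤ LinearMap.BilinForm.orthogonal ω L := by
    intro x hx y hy
    exact hL.2 y hy x hx
  have heq := Submodule.eq_of_le_of_finrank_eq hle (by rw [hf, hdim, hL.1]; omega)
  rw [heq]
  intro y hy
  exact hr _ _ (hv y hy)

/-- Stone–von Neumann: any finite-dimensional irreducible representation
`π` of the Heisenberg group with central character `ψ` is isomorphic, as an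
`H`-representation, to the model `(π_L, 𝓗_L)`, for every Lagrangian `L`. -/
theorem stmt_4 (n : ℕ) (F V : Type) [Field F] [Fintype F]
    (hq : Odd (Fintype.card F)) [AddCommGroup V] [Module F V] [Fintype V]
    (ω : V →ₗ[F] V →ₗ[F] F)
    (halt : ∀ v : V, ω v v = 0)
    (hnd : ∀ v : V, (∀ w : V, ω v w = 0) → v = 0)
    (hdim : Module.finrank F V = 2 * n)
    (ψ : F → ℂ) (hψadd : ∀ a b : F, ψ (a + b) = ψ a * ψ b) (hψ0 : ψ 0 = 1)
    (hψnt : ∃ a : F, ψ a ≠ 1)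
    (L : Submodule F V) (hL : IsLagrangian n ω L)
    (W : Type) [AddCommGroup W] [Module ℂ W] [FiniteDimensional ℂ W] [Nontrivial W]
    (π : V × F → (W →ₗ[ℂ] W))
    (hπone : π ((0 : V), (0 : F)) = LinearMap.id)
    (hπmul : ∀ a b : V × F, π (hmul ω a b) = (π a).comp (π b))
    (hπcent : ∀ z : F, π ((0 : V), z) = ψ z • (LinearMap.id : W →ₗ[ℂ] W))
    (hπirr : ∀ U : Submodule ℂ W, (∀ h : V × F, ∀ w ∈ U, π h w ∈ U) → U = ⊥ ∨ U = ⊤) :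
    ∃ T : W →ₗ[ℂ] ((V × F) → ℂ),
      Function.Injective T ∧
      LinearMap.range T = HeisModel ω ψ L ∧
      ∀ (h : V × F) (w : W), T (π h w) = rt ω h (T w) := by
  have h2 : (2 : F) ≠ 0 := by
    intro h
    have h3 : ringChar F = 2 := by
      have := ringChar.dvd (R := F) (x := 2) (by exact_mod_cast h)
      rcases (Nat.dvd_prime Nat.prime_two).1 this with h | h
      · exact absurd h (CharP.ringChar_ne_one)
      · exact h
    have := FiniteField.even_card_iff_char_two.1 h3
    rw [Nat.odd_iff] at hq
    omega
  have hsk : ∀ x y, ω x y = - ω y x := by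
    intro x y
    have := halt (x + y)
    simp only [map_add, LinearMap.add_apply, halt] at this
    linear_combination this
  have hψneg : ∀ a, ψ a * ψ (-a) = 1 := by intro a; rw [← hψadd, add_neg_cancel, hψ0]
  have hmul' : ∀ a b w, π (hmul ω a b) w = π a (π b w) := by
    intro a b w; rw [hπmul]; rfl
  have hz : ∀ (v : V) (z : F) (w : W), π (v, z) w = ψ z • π (v, 0) w := by
    intro v z w
    have : (v, z) = hmul ω (0, z) (v, 0) := by simp [hmul]
    rw [this, hmul', hπcent]; rfl
  classical
  -- the averaging projector
  set P : W →ₗ[ℂ] W := ∑ l : L, π ((l : V), 0) with hP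
  have hPL : ∀ l ∈ L, ∀ w, P (π (l, 0) w) = P w := by
    intro l hl w
    simp only [hP, LinearMap.sum_apply]
    refine Fintype.sum_equiv (Equiv.addRight (⟨l, hl⟩ : L)) _ _ (fun a => ?_)
    rw [← hmul']
    simp [hmul, hL.2 _ a.2 _ hl]
  have hconj : ∀ v w, π (v, 0) (P (π (-v, 0) w)) = ∑ l : L, ψ (ω v l) • π ((l : V), 0) w := by
    intro v w
    simp only [hP, LinearMap.sum_apply, map_sum]
    refine Finset.sum_congr rfl (fun l _ => ?_)
    rw [← hmul', ← hmul', ← hz]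
    congr 2
    simp only [hmul, map_add, map_neg, LinearMap.add_apply, Prod.mk.injEq]
    refine ⟨by abel, ?_⟩
    rw [halt, hsk (l : V) v]
    field_simp
    ring
  have hPne : P ≠ 0 := by
    intro h0
    obtain ⟨w, hw⟩ := exists_ne (0 : W)
    have h1 : ∑ v : V, ∑ l : L, ψ (ω v l) • π ((l : V), 0) w = 0 := by
      refine Finset.sum_eq_zero (fun v _ => ?_)
      rw [← hconj, h0]; simp
    rw [Finset.sum_comm] at h1
    simp only [← Finset.sum_smul] at h1
    rw [Finset.sum_eq_single (0 : L)] at h1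
    · simp [hψ0, hπone, hw] at h1
    · intro l _ hl
      have : ∃ v, ω v l ≠ 0 := by
        by_contra! hc
        apply hl
        apply Subtype.ext
        exact hnd _ (fun x => by rw [hsk, hc, neg_zero])
      obtain ⟨v, hv⟩ := this
      have := charsum ψ hψadd hψnt (ω.flip (l : V)) v hv
      simp only [LinearMap.flip_apply] at this
      rw [this, zero_smul]
    · simp
  obtain ⟨w0, hw0⟩ : ∃ w, P w ≠ 0 := by
    by_contra! hc
    exact hPne (LinearMap.ext hc)
  obtain ⟨μ, hμ⟩ : ∃ μ : Module.Dual ℂ W, μ (P w0) ≠ 0 := by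
    by_contra! hc
    exact hw0 ((Module.forall_dual_apply_eq_zero_iff ℂ _).1 hc)
  let T : W →ₗ[ℂ] ((V × F) → ℂ) := LinearMap.pi (fun h => (μ.comp P).comp (π h))
  have hT : ∀ w h, T w h = μ (P (π h w)) := fun _ _ => rfl
  have hTeq : ∀ (h : V × F) (w : W), T (π h w) = rt ω h (T w) := by
    intro h w
    funext h'
    simp only [rt, hT, hmul']
  have hTmem : ∀ w, T w ∈ HeisModel ω ψ L := by
    intro w l hl z h
    rw [hT, hT, hmul', hz, map_smul, map_smul, hPL l hl, smul_eq_mul]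
  refine ⟨T, ?_, ?_, hTeq⟩
  · rw [← LinearMap.ker_eq_bot]
    rcases hπirr (LinearMap.ker T) (by
      intro h w hw
      rw [LinearMap.mem_ker] at hw ⊢
      rw [hTeq, hw]; rfl) with h | h
    · exact h
    · exfalso
      have : T w0 = 0 := by rw [← LinearMap.mem_ker, h]; trivial
      apply hμ
      have := congrFun this (0, 0)
      rw [hT, hπone] at this
      exact this
  · apply le_antisymm
    · rintro _ ⟨w, rfl⟩
      exact hTmem w
    · intro g hg
      have hLc : (Fintype.card L : ℂ) ≠ 0 := by
        exact_mod_cast Fintype.card_ne_zero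
      have hδ : ∀ v z, T (P w0) (v, z) =
          if v ∈ L then ψ z * ((Fintype.card L : ℂ) * μ (P w0)) else 0 := by
        intro v z
        have e1 : T (P w0) (v, z) = ∑ l : L, ψ (ω v l) * T w0 (v, z) := by
          conv_lhs => rw [hP]
          rw [LinearMap.sum_apply, map_sum, Finset.sum_apply]
          refine Finset.sum_congr rfl (fun l _ => ?_)
          rw [hTeq, ← hTmem w0 l l.2]
          simp only [rt, hmul]
          refine congrArg (T w0) (Prod.ext (add_comm _ _) ?_)
          simp only
          rw [hsk (l : V) v]; field_simp; ring
        rw [e1, ← Finset.sum_mul]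
        split_ifs with hv
        · have e2 : T w0 (v, z) = ψ z * μ (P w0) := by
            have := hTmem w0 v hv z (0, 0)
            rw [hT w0 (0, 0), hπone] at this
            simpa [hmul] using this
          rw [e2]
          have e3 : ∑ l : L, ψ (ω v l) = (Fintype.card L : ℂ) := by
            simp [hL.2 v hv _ (Subtype.property _), hψ0]
          rw [e3]; ring
        · have : ∃ l : L, ω v l ≠ 0 := by
            by_contra! hc
            exact hv (lag_perp n ω halt hnd hdim L hL v (fun l hl => hc ⟨l, hl⟩))
          obtain ⟨l, hl⟩ := this
          have := charsum ψ hψadd hψnt ((ω v).comp L.subtype) l hl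
          simp only [LinearMap.comp_apply, Submodule.subtype_apply] at this
          rw [this, zero_mul]
      set c : ℂ := (Fintype.card L : ℂ) * μ (P w0) with hc
      have hc0 : c ≠ 0 := mul_ne_zero hLc hμ
      refine ⟨((Fintype.card L : ℂ) * c)⁻¹ • ∑ v : V, g (-v, 0) • π (v, 0) (P w0), ?_⟩
      funext ⟨v', z'⟩
      rw [map_smul, map_sum, Pi.smul_apply, Finset.sum_apply, smul_eq_mul]
      have key : ∑ v : V, T (g (-v, 0) • π (v, 0) (P w0)) (v', z') =
          ∑ l : L, c * g (v', z') := by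
        rw [← Fintype.sum_equiv (Equiv.addRight (-v')) (fun v : V =>
          T (g (-(v - v'), 0) • π (v - v', 0) (P w0)) (v', z')) _
          (fun v => by simp [sub_eq_add_neg])]
        have e4 : ∀ v : V, T (g (-(v - v'), 0) • π (v - v', 0) (P w0)) (v', z') =
            if v ∈ L then c * g (v', z') else 0 := by
          intro v
          rw [map_smul, Pi.smul_apply, smul_eq_mul, hTeq]
          simp only [rt, hmul]
          rw [hδ]
          simp only [add_sub_cancel]
          split_ifs with hv
          · have := hg (-v) (L.neg_mem hv) (-z' + 2⁻¹ * ω v v') (v', z')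
            have e5 : hmul ω (-v, -z' + 2⁻¹ * ω v v') (v', z') = (-(v - v'), 0) := by
              simp only [hmul, map_neg, LinearMap.neg_apply, Prod.mk.injEq]
              exact ⟨by abel, by ring⟩
            rw [e5] at this
            rw [this]
            have e6 : z' + 0 + 2⁻¹ * ω v' (v - v') = -(-z' + 2⁻¹ * ω v v') := by
              rw [map_sub, halt, hsk v' v]; ring
            rw [e6]
            linear_combination (c * g (v', z')) * hψneg (-z' + 2⁻¹ * ω v v')
          · simp
        simp only [e4]
        rw [← Finset.sum_filter]
        simp [Fintype.card_subtype]
      rw [key]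
      simp only [Finset.sum_const, Finset.card_univ, nsmul_eq_mul]
      field_simp

end Stmt4
end

section
/- For any two Lagrangian subspaces L, M ⊂ V, the space Hom_H(𝓗_L, 𝓗_M) of H-intertwining linear maps between the models is one-dimensional over ℂ. -/
namespace Stmt5

/-- Heisenberg multiplication on `V × F`: `(v,z)·(v',z') = (v+v', z+z'+½ω(v,v'))`. -/
def hmul {F V : Type} [Field F] [AddCommGroup V] [Module F V]
    (ω : V →ₗ[F] V →ₗ[F] F) (a b : V × F) : V × F :=
  (a.1 + b.1, a.2 + b.2 + (2 : F)⁻¹ * ω a.1 b.1)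

/-- A Lagrangian subspace: `n`-dimensional and `ω` vanishes identically on it. -/
def IsLagrangian {F V : Type} [Field F] [AddCommGroup V] [Module F V]
    (n : ℕ) (ω : V →ₗ[F] V →ₗ[F] F) (L : Submodule F V) : Prop :=
  Module.finrank F L = n ∧ ∀ x ∈ L, ∀ y ∈ L, ω x y = 0

/-- Right translation `(π(h)f)(h') = f(h'·h)`. -/
def rt {F V : Type} [Field F] [AddCommGroup V] [Module F V]
    (ω : V →ₗ[F] V →ₗ[F] F) (h : V × F) (f : (V × F) → ℂ) : (V × F) → ℂ :=
  fun h' => f (hmul ω h' h)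

/-- The model `𝓗_L = {f : H → ℂ | f((l,z)·h) = ψ(z)·f(h) for l ∈ L, z ∈ F}`,
as a complex subspace of the space of functions on the Heisenberg group. -/
noncomputable def HeisModel {F V : Type} [Field F] [AddCommGroup V] [Module F V]
    (ω : V →ₗ[F] V →ₗ[F] F) (ψ : F → ℂ) (L : Submodule F V) :
    Submodule ℂ ((V × F) → ℂ) where
  carrier := {f | ∀ l ∈ L, ∀ (z : F) (h : V × F), f (hmul ω (l, z) h) = ψ z * f h}
  add_mem' := by
    intro f g hf hg l hl z h
    simp only [Pi.add_apply, hf l hl z h, hg l hl z h, mul_add]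
  zero_mem' := by
    intro l hl z h
    simp
  smul_mem' := by
    intro c f hf l hl z h
    simp only [Pi.smul_apply, hf l hl z h, smul_eq_mul]
    ring

/-- The space `Hom_H(𝓗_L, 𝓗_M)` of intertwining linear maps: linear maps
`T : 𝓗_L → 𝓗_M` commuting with the right-translation action of the Heisenberg group
(phrased via ambient functions: whenever `g = π_L(h) f` then `T g = π_M(h) (T f)`). -/
noncomputable def IntertwinerSub {F V : Type} [Field F] [AddCommGroup V] [Module F V]
    (ω : V →ₗ[F] V →ₗ[F] F) (ψ : F → ℂ) (L M : Submodule F V) :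
    @Submodule ℂ ((HeisModel ω ψ L) →ₗ[ℂ] (HeisModel ω ψ M)) Complex.instSemiring
      (@AddCommGroup.toAddCommMonoid _ LinearMap.addCommGroup) LinearMap.module where
  carrier := {T | ∀ (h : V × F) (f g : HeisModel ω ψ L),
      (g : (V × F) → ℂ) = rt ω h (f : (V × F) → ℂ) →
      (T g : (V × F) → ℂ) = rt ω h (T f : (V × F) → ℂ)}
  add_mem' := by
    intro T S hT hS h f g hg
    have h1 := hT h f g hg
    have h2 := hS h f g hg
    funext x
    simp only [LinearMap.add_apply, Submodule.coe_add, Pi.add_apply, rt] at h1 h2 ⊢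
    rw [congrFun h1 x, congrFun h2 x]
    rfl
  zero_mem' := by
    intro h f g hg
    funext x
    simp [rt]
  smul_mem' := by
    intro c T hT h f g hg
    have h1 := hT h f g hg
    funext x
    simp only [LinearMap.smul_apply, SetLike.val_smul, Pi.smul_apply, rt] at h1 ⊢
    rw [congrFun h1 x]
    rfl

section Helpers

variable {F V : Type} [Field F] [AddCommGroup V] [Module F V]

lemma mem_model {ω : V →ₗ[F] V →ₗ[F] F} {ψ : F → ℂ} {L : Submodule F V} {f : (V × F) → ℂ} :
    f ∈ HeisModel ω ψ L ↔
      ∀ l ∈ L, ∀ (z : F) (h : V × F), f (hmul ω (l, z) h) = ψ z * f h := Iff.rfl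

lemma hmul_assoc (ω : V →ₗ[F] V →ₗ[F] F) (a b c : V × F) :
    hmul ω (hmul ω a b) c = hmul ω a (hmul ω b c) := by
  refine Prod.ext ?_ ?_
  · simp [hmul, add_assoc]
  · simp only [hmul, map_add, LinearMap.add_apply]
    ring

lemma rt_mem {ω : V →ₗ[F] V →ₗ[F] F} {ψ : F → ℂ} {L : Submodule F V} {f : (V × F) → ℂ}
    (hf : f ∈ HeisModel ω ψ L) (h : V × F) : rt ω h f ∈ HeisModel ω ψ L := by
  intro l hl z h'
  simp only [rt, hmul_assoc]
  exact hf l hl z _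

open Classical in
/-- The function supported on `L × F`. -/
noncomputable def dl (ψ : F → ℂ) (L : Submodule F V) : (V × F) → ℂ :=
  fun h => if h.1 ∈ L then ψ h.2 else 0

lemma dl_mem (ω : V →ₗ[F] V →ₗ[F] F) (ψ : F → ℂ) (hψadd : ∀ a b : F, ψ (a + b) = ψ a * ψ b)
    (L : Submodule F V) (hL : ∀ x ∈ L, ∀ y ∈ L, ω x y = 0) : dl ψ L ∈ HeisModel ω ψ L := by
  intro l hl z h
  by_cases hh : h.1 ∈ L
  · have : l + h.1 ∈ L := L.add_mem hl hh
    simp [dl, hmul, hh, this, hL l hl _ hh, hψadd]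
  · have : l + h.1 ∉ L := fun h' => hh ((L.add_mem_iff_right hl).1 h')
    simp [dl, hmul, hh, this]

lemma dl_inv (ω : V →ₗ[F] V →ₗ[F] F) (ψ : F → ℂ)
    (L : Submodule F V) (hL : ∀ x ∈ L, ∀ y ∈ L, ω x y = 0) (l : V) (hl : l ∈ L) :
    rt ω (l, 0) (dl ψ L) = dl ψ L := by
  funext h
  by_cases hh : h.1 ∈ L
  · have : h.1 + l ∈ L := L.add_mem hh hl
    simp [dl, rt, hmul, hh, this, hL _ hh l hl]
  · have : h.1 + l ∉ L := fun h' => hh ((L.add_mem_iff_left hl).1 h')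
    simp [dl, rt, hmul, hh, this]

lemma omega_swap (ω : V →ₗ[F] V →ₗ[F] F) (halt : ∀ v : V, ω v v = 0) (x y : V) :
    ω x y = - ω y x := by
  have h := halt (x + y)
  simp only [map_add, LinearMap.add_apply, halt] at h
  linear_combination h

/-- every vector orthogonal to `L ∩ M` lies in `L + M`. -/
lemma mem_sup [Fintype V] (n : ℕ) (ω : V →ₗ[F] V →ₗ[F] F) (halt : ∀ v : V, ω v v = 0)
    (hnd : ∀ v : V, (∀ w : V, ω v w = 0) → v = 0)
    (hdim : Module.finrank F V = 2 * n)
    (L M : Submodule F V) (hL : IsLagrangian n ω L) (hM : IsLagrangian n ω M)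
    (v : V) (hv : ∀ x ∈ L ⊓ M, ω x v = 0) : v ∈ L ⊔ M := by
  have hfin : Module.Finite F V := Module.Finite.of_finite
  let B : LinearMap.BilinForm F V := ω
  have hrefl : B.IsRefl := by
    intro x y h
    have : ω y x = - ω x y := omega_swap ω halt y x
    have h' : ω x y = 0 := h
    show ω y x = 0
    rw [this, h', neg_zero]
  have hB : B.Nondegenerate := by
    refine ⟨hnd, ?_⟩
    intro y hy
    exact hnd y fun w => hrefl _ _ (hy w)
  have h1 := LinearMap.BilinForm.finrank_orthogonal hB (L ⊓ M)
  have h2 := Submodule.finrank_sup_add_finrank_inf_eq L M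
  have hle : L ⊔ M ≤ B.orthogonal (L ⊓ M) := by
    refine sup_le ?_ ?_
    · intro y hy x hx
      exact hL.2 x hx.1 y hy
    · intro y hy x hx
      exact hM.2 x hx.2 y hy
  have h3 : L ⊔ M = B.orthogonal (L ⊓ M) := by
    apply Submodule.eq_of_le_of_finrank_eq hle
    rw [hL.1, hM.1] at h2
    omega
  rw [h3]
  exact fun x hx => hv x hx

/-- uniqueness of the `L`-invariant vector in the model of `M`. -/
lemma inv_unique [Fintype V] (n : ℕ) (ω : V →ₗ[F] V →ₗ[F] F) (halt : ∀ v : V, ω v v = 0)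
    (hnd : ∀ v : V, (∀ w : V, ω v w = 0) → v = 0)
    (hdim : Module.finrank F V = 2 * n) (h2 : (2 : F) ≠ 0)
    (ψ : F → ℂ) (hψadd : ∀ a b : F, ψ (a + b) = ψ a * ψ b) (hψ0 : ψ 0 = 1)
    (hψnt : ∃ a : F, ψ a ≠ 1)
    (L M : Submodule F V) (hL : IsLagrangian n ω L) (hM : IsLagrangian n ω M)
    (g : (V × F) → ℂ) (hg : g ∈ HeisModel ω ψ M) (hinv : ∀ l ∈ L, rt ω (l, 0) g = g)
    (h00 : g (0, 0) = 0) : g = 0 := by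
  have hz : ∀ v z, g (v, z) = ψ z * g (v, 0) := by
    intro v z
    have := hg 0 M.zero_mem z (v, 0)
    simpa [hmul] using this
  have hne : ∀ z, ψ z ≠ 0 := by
    intro z hz
    have := hψadd z (-z)
    rw [add_neg_cancel, hψ0, hz, zero_mul] at this
    exact one_ne_zero this
  have hv : ∀ v, g (v, 0) = 0 := by
    intro v
    by_contra hgv
    have hmem : v ∈ L ⊔ M := by
      refine mem_sup n ω halt hnd hdim L M hL hM v ?_
      intro x hx
      by_contra hxv
      obtain ⟨a, ha⟩ := hψnt
      apply ha
      have key : ∀ y ∈ L ⊓ M, ψ (ω y v) = 1 := by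
        intro y hy
        have e1 := hg y hy.2 0 (v, 0)
        have e2 := congrFun (hinv y hy.1) (v, 0)
        simp only [hmul, rt, add_zero, zero_add, hψ0, one_mul] at e1 e2
        rw [hz] at e1 e2
        rw [add_comm v y, omega_swap ω halt v y] at e2
        have e3 : ψ ((2 : F)⁻¹ * ω y v) = ψ ((2 : F)⁻¹ * -ω y v) := by
          have : g (y + v, 0) ≠ 0 := by
            intro h
            rw [h, mul_zero] at e1
            exact hgv e1.symm
          exact mul_right_cancel₀ this (e1.trans e2.symm)
        have e4 : ω y v = (2 : F)⁻¹ * ω y v + (2 : F)⁻¹ * ω y v := by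
          field_simp
          ring
        rw [e4, hψadd]
        nth_rewrite 1 [e3]
        rw [← hψadd, ← hψ0]
        congr 1
        ring
      have := key ((a / ω x v) • x) (Submodule.smul_mem _ _ hx)
      rwa [map_smul, LinearMap.smul_apply, smul_eq_mul, div_mul_cancel₀ _ hxv] at this
    obtain ⟨l, hl, m, hm, rfl⟩ := Submodule.mem_sup.1 hmem
    have e1 := hg m hm 0 (l, 0)
    have e2 := congrFun (hinv l hl) (0, 0)
    simp only [hmul, rt, add_zero, zero_add, hψ0, one_mul, map_zero, LinearMap.zero_apply,
      mul_zero] at e1 e2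
    rw [e2, h00, hz, add_comm m l] at e1
    exact (mul_ne_zero (hne _) hgv) e1
  funext h
  obtain ⟨v, z⟩ := h
  rw [hz, hv, mul_zero]
  rfl

/-- Expansion of a function in the model in terms of translates of `dl`. -/
lemma expand [Fintype V] (ω : V →ₗ[F] V →ₗ[F] F) (halt : ∀ v : V, ω v v = 0)
    (h2 : (2 : F) ≠ 0)
    (ψ : F → ℂ) (hψadd : ∀ a b : F, ψ (a + b) = ψ a * ψ b) (hψ0 : ψ 0 = 1)
    (L : Submodule F V)
    (f : (V × F) → ℂ) (hf : f ∈ HeisModel ω ψ L) :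
    f = ∑ v : V, ((Nat.card L : ℂ)⁻¹ * f (v, 0)) • rt ω (-v, 0) (dl ψ L) := by
  classical
  funext h
  obtain ⟨u, z⟩ := h
  have hz : ∀ v z, f (v, z) = ψ z * f (v, 0) := by
    intro v z
    have := hf 0 L.zero_mem z (v, 0)
    simpa [hmul] using this
  have hterm : ∀ v : V, (((Nat.card L : ℂ)⁻¹ * f (v, 0)) • rt ω (-v, 0) (dl ψ L)) (u, z)
      = if u - v ∈ L then (Nat.card L : ℂ)⁻¹ * f (u, z) else 0 := by
    intro v
    simp only [Pi.smul_apply, smul_eq_mul, rt, dl, hmul, ← sub_eq_add_neg, add_zero]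
    split_ifs with hv
    · have e := hf (u - v) hv 0 (v, 0)
      simp only [hmul, sub_add_cancel, zero_add, hψ0, one_mul, map_sub, LinearMap.sub_apply,
        halt, sub_zero] at e
      rw [← e, hz u z, hz u (_ * _), hψadd]
      have : ψ ((2 : F)⁻¹ * ω u v) * ψ ((2 : F)⁻¹ * ω u (-v)) = 1 := by
        rw [← hψadd, ← hψ0]
        congr 1
        rw [map_neg]
        ring
      linear_combination (Nat.card L : ℂ)⁻¹ * ψ z * f (u, 0) * this
    · simp
  rw [Finset.sum_apply]
  rw [Finset.sum_congr rfl fun v _ => hterm v]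
  rw [← (Equiv.subLeft u).sum_comp]
  simp only [Equiv.subLeft_apply, sub_sub_cancel]
  rw [← Finset.sum_filter, Finset.sum_const]
  have hc : (Finset.univ.filter fun v : V => v ∈ L).card = Nat.card L := by
    rw [← Fintype.card_subtype, Nat.card_eq_fintype_card]
  rw [hc, nsmul_eq_mul, ← mul_assoc, mul_inv_cancel₀, one_mul]
  exact_mod_cast (ne_of_gt Nat.card_pos)

/-- The averaging intertwiner. -/
noncomputable def T0 [Fintype V] (ω : V →ₗ[F] V →ₗ[F] F) (ψ : F → ℂ)
    (L M : Submodule F V) (hM : ∀ x ∈ M, ∀ y ∈ M, ω x y = 0)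
    (hψadd : ∀ a b : F, ψ (a + b) = ψ a * ψ b) (hψ0 : ψ 0 = 1) :
    HeisModel ω ψ L →ₗ[ℂ] HeisModel ω ψ M where
  toFun f := ⟨fun h => ∑ᶠ m : M, (f : (V × F) → ℂ) (hmul ω ((m : V), 0) h), by
    have hf0 := f.2
    intro m' hm' z h
    have hz : ∀ h' : V × F, (f : (V × F) → ℂ) (hmul ω (0, z) h') = ψ z * (f : (V × F) → ℂ) h' :=
      fun h' => hf0 0 L.zero_mem z h'
    show ∑ᶠ m : M, (f : (V × F) → ℂ) (hmul ω ((m : V), 0) (hmul ω (m', z) h))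
      = ψ z * ∑ᶠ m : M, (f : (V × F) → ℂ) (hmul ω ((m : V), 0) h)
    rw [mul_finsum' _ _ (Set.toFinite _)]
    rw [← finsum_comp_equiv (Equiv.addRight (⟨m', hm'⟩ : M)) (f := fun m : M => ψ z * (f : (V × F) → ℂ) (hmul ω ((m : V), 0) h))]
    refine finsum_congr fun m => ?_
    rw [← hz, ← hmul_assoc, ← hmul_assoc]
    congr 2
    simp [hmul, hM m m.2 m' hm']⟩
  map_add' f g := by
    ext h
    exact finsum_add_distrib (Set.toFinite _) (Set.toFinite _)
  map_smul' c f := by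
    ext h
    exact (smul_finsum c _).symm

lemma T0_mem [Fintype V] (ω : V →ₗ[F] V →ₗ[F] F) (ψ : F → ℂ)
    (L M : Submodule F V) (hM : ∀ x ∈ M, ∀ y ∈ M, ω x y = 0)
    (hψadd : ∀ a b : F, ψ (a + b) = ψ a * ψ b) (hψ0 : ψ 0 = 1) :
    T0 ω ψ L M hM hψadd hψ0 ∈ IntertwinerSub ω ψ L M := by
  intro h f g hfg
  funext x
  show ∑ᶠ m : M, (g : (V × F) → ℂ) (hmul ω ((m : V), 0) x)
    = ∑ᶠ m : M, (f : (V × F) → ℂ) (hmul ω ((m : V), 0) (hmul ω x h))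
  rw [hfg]
  simp only [rt, hmul_assoc]

lemma T0_ne [Fintype V] (ω : V →ₗ[F] V →ₗ[F] F) (ψ : F → ℂ)
    (L M : Submodule F V) (hM : ∀ x ∈ M, ∀ y ∈ M, ω x y = 0)
    (hψadd : ∀ a b : F, ψ (a + b) = ψ a * ψ b) (hψ0 : ψ 0 = 1)
    (d : HeisModel ω ψ L) (hd : (d : (V × F) → ℂ) = dl ψ L) :
    (T0 ω ψ L M hM hψadd hψ0 d : (V × F) → ℂ) (0, 0) ≠ 0 := by
  classical
  show ∑ᶠ m : M, (d : (V × F) → ℂ) (hmul ω ((m : V), 0) (0, 0)) ≠ 0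
  rw [hd, finsum_eq_sum_of_fintype]
  simp only [dl, hmul, add_zero, map_zero, mul_zero, hψ0]
  rw [Finset.sum_boole]
  have : (Finset.univ.filter fun m : M => (m : V) ∈ L).card ≠ 0 := by
    rw [Finset.card_ne_zero]
    exact ⟨0, by simp⟩
  exact_mod_cast this

lemma rank_sub_one {E : Type} [AddCommGroup E] [Module ℂ E] (W : Submodule ℂ E)
    (h : ∃ v : W, v ≠ 0 ∧ ∀ w : W, ∃ r : ℂ, r • v = w) : Module.rank ℂ W = 1 :=
  rank_eq_one_iff.2 h

lemma sub_smul_mem {E : Type} [AddCommGroup E] [Module ℂ E] (W : Submodule ℂ E)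
    (r : ℂ) (v w : E) (hv : v ∈ W) (hw : w ∈ W) : v - r • w ∈ W :=
  W.sub_mem hv (W.smul_mem r hw)

end Helpers

set_option synthInstance.maxHeartbeats 1000000 in
set_option maxHeartbeats 1000000 in
/-- for any two Lagrangians `L, M`, the space `Hom_H(𝓗_L, 𝓗_M)` of
`H`-intertwining maps is one-dimensional over `ℂ`. -/
theorem stmt_5 (n : ℕ) (F V : Type) [Field F] [Fintype F]
    (hq : Odd (Fintype.card F)) [AddCommGroup V] [Module F V] [Fintype V]
    (ω : V →ₗ[F] V →ₗ[F] F)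
    (halt : ∀ v : V, ω v v = 0)
    (hnd : ∀ v : V, (∀ w : V, ω v w = 0) → v = 0)
    (hdim : Module.finrank F V = 2 * n)
    (ψ : F → ℂ) (hψadd : ∀ a b : F, ψ (a + b) = ψ a * ψ b) (hψ0 : ψ 0 = 1)
    (hψnt : ∃ a : F, ψ a ≠ 1)
    (L M : Submodule F V) (hL : IsLagrangian n ω L) (hM : IsLagrangian n ω M) :
    Module.rank ℂ (IntertwinerSub ω ψ L M) = 1 := by
  have h2 : (2 : F) ≠ 0 := by
    apply Ring.two_ne_zero
    intro hc
    have := FiniteField.even_card_of_char_two hc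
    rw [Nat.odd_iff] at hq
    omega
  let d : HeisModel ω ψ L := ⟨dl ψ L, dl_mem ω ψ hψadd L hL.2⟩
  let S := T0 ω ψ L M hM.2 hψadd hψ0
  have hS : S ∈ IntertwinerSub ω ψ L M := T0_mem ω ψ L M hM.2 hψadd hψ0
  have hS0 : (S d : (V × F) → ℂ) (0, 0) ≠ 0 := T0_ne ω ψ L M hM.2 hψadd hψ0 d rfl
  have huniq : ∀ T ∈ IntertwinerSub ω ψ L M, (T d : (V × F) → ℂ) (0, 0) = 0 → T = 0 := by
    intro T hT hT0
    have hTd : (T d : (V × F) → ℂ) = 0 := by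
      refine inv_unique n ω halt hnd hdim h2 ψ hψadd hψ0 hψnt L M hL hM _ (T d).2 ?_ hT0
      intro l hl
      exact (hT (l, 0) d d (dl_inv ω ψ L hL.2 l hl).symm).symm
    have hTr : ∀ v : V, T ⟨rt ω (-v, 0) (dl ψ L), rt_mem d.2 _⟩ = 0 := by
      intro v
      apply Subtype.ext
      rw [hT (-v, 0) d _ rfl, hTd]
      rfl
    apply LinearMap.ext
    intro f
    have hf : f = ∑ v : V, ((Nat.card L : ℂ)⁻¹ * (f : (V × F) → ℂ) (v, 0)) •
        (⟨rt ω (-v, 0) (dl ψ L), rt_mem d.2 _⟩ : HeisModel ω ψ L) := by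
      apply Subtype.ext
      rw [Submodule.coe_sum]
      exact expand ω halt h2 ψ hψadd hψ0 L f f.2
    rw [hf, map_sum]
    refine Finset.sum_eq_zero fun v _ => ?_
    rw [map_smul, hTr, smul_zero]
  refine @rank_sub_one ((HeisModel ω ψ L) →ₗ[ℂ] (HeisModel ω ψ M)) LinearMap.addCommGroup LinearMap.module
    (IntertwinerSub ω ψ L M) ?_
  refine ⟨⟨S, hS⟩, ?_, ?_⟩
  · intro h
    have h' : S = 0 := congrArg Subtype.val h
    apply hS0
    rw [h']
    rfl
  · rintro ⟨T, hT⟩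
    let r : ℂ := (T d : (V × F) → ℂ) (0, 0) / (S d : (V × F) → ℂ) (0, 0)
    refine ⟨r, ?_⟩
    apply Subtype.ext
    show r • S = T
    have := huniq (T - r • S) (@sub_smul_mem ((HeisModel ω ψ L) →ₗ[ℂ] (HeisModel ω ψ M))
      LinearMap.addCommGroup LinearMap.module (IntertwinerSub ω ψ L M) r T S hT hS) (by
      show (T d : (V × F) → ℂ) (0, 0) - r * (S d : (V × F) → ℂ) (0, 0) = 0
      rw [div_mul_cancel₀ _ hS0, sub_self])
    exact (sub_eq_zero.1 this).symm

end Stmt5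
end

section
/- Let L, M ⊂ V be Lagrangian subspaces in general position, i.e., L ∩ M = 0. Then the averaging operator F̃_{M,L} defined by F̃_{M,L}[f](h) = Σ_{m∈M} f((m,0)·h) maps 𝓗_L into 𝓗_M, satisfies F̃_{M,L}∘π_L(h) = π_M(h)∘F̃_{M,L} for all h ∈ H, and is a linear isomorphism from 𝓗_L onto 𝓗_M. -/
namespace Stmt6

/-- Heisenberg multiplication on `V × F`: `(v,z)·(v',z') = (v+v', z+z'+½ω(v,v'))`. -/
def hmul {F V : Type} [Field F] [AddCommGroup V] [Module F V]
    (ω : V →ₗ[F] V →ₗ[F] F) (a b : V × F) : V × F :=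
  (a.1 + b.1, a.2 + b.2 + (2 : F)⁻¹ * ω a.1 b.1)

/-- A Lagrangian subspace: `n`-dimensional and `ω` vanishes identically on it. -/
def IsLagrangian {F V : Type} [Field F] [AddCommGroup V] [Module F V]
    (n : ℕ) (ω : V →ₗ[F] V →ₗ[F] F) (L : Submodule F V) : Prop :=
  Module.finrank F L = n ∧ ∀ x ∈ L, ∀ y ∈ L, ω x y = 0

/-- Right translation `(π(h)f)(h') = f(h'·h)`. -/
def rt {F V : Type} [Field F] [AddCommGroup V] [Module F V]
    (ω : V →ₗ[F] V →ₗ[F] F) (h : V × F) (f : (V × F) → ℂ) : (V × F) → ℂ :=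
  fun h' => f (hmul ω h' h)

/-- The model `𝓗_L = {f : H → ℂ | f((l,z)·h) = ψ(z)·f(h) for l ∈ L, z ∈ F}`,
as a complex subspace of the space of functions on the Heisenberg group. -/
noncomputable def HeisModel {F V : Type} [Field F] [AddCommGroup V] [Module F V]
    (ω : V →ₗ[F] V →ₗ[F] F) (ψ : F → ℂ) (L : Submodule F V) :
    Submodule ℂ ((V × F) → ℂ) where
  carrier := {f | ∀ l ∈ L, ∀ (z : F) (h : V × F), f (hmul ω (l, z) h) = ψ z * f h}
  add_mem' := by
    intro f g hf hg l hl z h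
    simp only [Pi.add_apply, hf l hl z h, hg l hl z h, mul_add]
  zero_mem' := by
    intro l hl z h
    simp
  smul_mem' := by
    intro c f hf l hl z h
    simp only [Pi.smul_apply, hf l hl z h, smul_eq_mul]
    ring

/-- The averaging operator `F̃_{M,L}[f](h) = Σ_{m ∈ M} f((m,0)·h)`. -/
noncomputable def avg {F V : Type} [Field F] [AddCommGroup V] [Module F V]
    (ω : V →ₗ[F] V →ₗ[F] F) (M : Submodule F V) (f : (V × F) → ℂ) : (V × F) → ℂ :=
  fun h => ∑ᶠ m ∈ (M : Set V), f (hmul ω (m, (0 : F)) h)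

section helpers
variable {F V : Type} [Field F] [AddCommGroup V] [Module F V]

theorem hmul_assoc' (ω : V →ₗ[F] V →ₗ[F] F) (a b c : V × F) :
    hmul ω (hmul ω a b) c = hmul ω a (hmul ω b c) := by
  ext
  · simp [hmul, add_assoc]
  · simp only [hmul, map_add, LinearMap.add_apply]; ring

theorem avg_apply [Fintype V] (ω : V →ₗ[F] V →ₗ[F] F) (M : Submodule F V) [Fintype M]
    (f : (V × F) → ℂ) (h : V × F) :
    avg ω M f h = ∑ m : M, f (hmul ω ((m : V), (0 : F)) h) := by
  unfold avg
  rw [← finsum_set_coe_eq_finsum_mem, ← finsum_eq_sum_of_fintype]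
  rfl

theorem avg_add [Fintype V] (ω : V →ₗ[F] V →ₗ[F] F) (M : Submodule F V)
    (f g : (V × F) → ℂ) : avg ω M (f + g) = avg ω M f + avg ω M g := by
  classical
  have := Fintype.ofFinite M
  ext h
  simp [avg_apply, Finset.sum_add_distrib]

theorem avg_smul [Fintype V] (ω : V →ₗ[F] V →ₗ[F] F) (M : Submodule F V)
    (c : ℂ) (f : (V × F) → ℂ) : avg ω M (c • f) = c • avg ω M f := by
  classical
  have := Fintype.ofFinite M
  ext h
  simp [avg_apply, Finset.mul_sum]

theorem avg_rt [Fintype V] (ω : V →ₗ[F] V →ₗ[F] F) (M : Submodule F V)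
    (h : V × F) (f : (V × F) → ℂ) : avg ω M (rt ω h f) = rt ω h (avg ω M f) := by
  classical
  have := Fintype.ofFinite M
  ext h'
  simp [avg_apply, rt, hmul_assoc']

theorem avg_mem [Fintype V] (ω : V →ₗ[F] V →ₗ[F] F) (ψ : F → ℂ) (L M : Submodule F V)
    (hM : ∀ x ∈ M, ∀ y ∈ M, ω x y = 0) (f : (V × F) → ℂ) (hf : f ∈ HeisModel ω ψ L) :
    avg ω M f ∈ HeisModel ω ψ M := by
  classical
  have := Fintype.ofFinite M
  intro l hl z h
  rw [avg_apply, avg_apply, Finset.mul_sum]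
  refine Fintype.sum_equiv (Equiv.addRight (⟨l, hl⟩ : M)) _ _ ?_
  intro m
  rw [← hf 0 L.zero_mem z]
  congr 1
  have h1 := hM m m.2 l hl
  ext
  · simp [hmul, add_assoc]
  · simp [hmul, h1]
    ring

theorem avg_avg [Fintype V] (h2 : (2 : F) ≠ 0) (ω : V →ₗ[F] V →ₗ[F] F)
    (halt : ∀ v : V, ω v v = 0)
    (hnd : ∀ v : V, (∀ w : V, ω v w = 0) → v = 0)
    (ψ : F → ℂ) (hψadd : ∀ a b : F, ψ (a + b) = ψ a * ψ b) (hψ0 : ψ 0 = 1)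
    (hψnt : ∃ a : F, ψ a ≠ 1)
    (L M : Submodule F V) (hM : ∀ x ∈ M, ∀ y ∈ M, ω x y = 0)
    (hLM : L ⊔ M = ⊤) (f : (V × F) → ℂ) (hf : f ∈ HeisModel ω ψ L) :
    avg ω L (avg ω M f) = (Nat.card L : ℂ) • f := by
  classical
  have := Fintype.ofFinite M
  have := Fintype.ofFinite L
  ext h
  have key : ∀ (l : L) (m : M), f (hmul ω ((m : V), (0 : F)) (hmul ω ((l : V), (0 : F)) h))
      = ψ (ω m l) * f (hmul ω ((m : V), (0 : F)) h) := by
    intro l m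
    rw [← hf l l.2 (ω m l), ← hmul_assoc', ← hmul_assoc']
    congr 2
    have hs : ω (l : V) (m : V) = - ω (m : V) (l : V) := by
      have := halt ((l : V) + m)
      simp only [map_add, LinearMap.add_apply, halt] at this
      linear_combination this
    ext
    · simp [hmul, add_comm]
    · simp only [hmul, hs]
      field_simp
      ring
  have hsum : ∀ m : M, m ≠ 0 → ∑ l : L, ψ (ω m l) = 0 := by
    intro m hm
    obtain ⟨l₀, hl₀⟩ : ∃ l : L, ω m l ≠ 0 := by
      by_contra! hcon
      apply hm
      have : (m : V) = 0 := by
        apply hnd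
        intro w
        have hw : w ∈ L ⊔ M := hLM ▸ Submodule.mem_top
        obtain ⟨x, hx, y, hy, rfl⟩ := Submodule.mem_sup.1 hw
        rw [map_add, hcon ⟨x, hx⟩, hM m m.2 y hy, add_zero]
      exact_mod_cast this
    obtain ⟨a, ha⟩ := hψnt
    let l₁ : L := (a * (ω m l₀)⁻¹) • l₀
    have hl₁ : ω m l₁ = a := by
      simp [l₁, hl₀]
    have : ∑ l : L, ψ (ω m l) = ψ a * ∑ l : L, ψ (ω m l) := by
      rw [Finset.mul_sum]
      symm
      refine Fintype.sum_equiv (Equiv.addLeft l₁) _ _ ?_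
      intro l
      simp [hl₁, hψadd]
    have h3 : (ψ a - 1) * ∑ l : L, ψ (ω m l) = 0 := by linear_combination -this
    exact (mul_eq_zero.1 h3).resolve_left (sub_ne_zero.2 ha)
  rw [avg_apply]
  simp_rw [avg_apply, key]
  rw [Finset.sum_comm]
  simp_rw [← Finset.sum_mul]
  rw [Finset.sum_eq_single (0 : M)]
  · simp [hψ0, hmul]
  · intro m _ hm
    rw [hsum m hm, zero_mul]
  · simp

end helpers

/-- for Lagrangians `L, M` in general position (`L ∩ M = 0`), the averaging
operator `F̃_{M,L}` maps `𝓗_L` into `𝓗_M`, intertwines the `H`-actions, and is a linear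
isomorphism of `𝓗_L` onto `𝓗_M`. -/
theorem stmt_6 (n : ℕ) (F V : Type) [Field F] [Fintype F]
    (hq : Odd (Fintype.card F)) [AddCommGroup V] [Module F V] [Fintype V]
    (ω : V →ₗ[F] V →ₗ[F] F)
    (halt : ∀ v : V, ω v v = 0)
    (hnd : ∀ v : V, (∀ w : V, ω v w = 0) → v = 0)
    (hdim : Module.finrank F V = 2 * n)
    (ψ : F → ℂ) (hψadd : ∀ a b : F, ψ (a + b) = ψ a * ψ b) (hψ0 : ψ 0 = 1)
    (hψnt : ∃ a : F, ψ a ≠ 1)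
    (L M : Submodule F V) (hL : IsLagrangian n ω L) (hM : IsLagrangian n ω M)
    (hLM : L ⊓ M = ⊥) :
    (∀ f ∈ HeisModel ω ψ L, avg ω M f ∈ HeisModel ω ψ M) ∧
    (∀ h : V × F, ∀ f ∈ HeisModel ω ψ L, avg ω M (rt ω h f) = rt ω h (avg ω M f)) ∧
    (∀ f g : (V × F) → ℂ, avg ω M (f + g) = avg ω M f + avg ω M g) ∧
    (∀ (c : ℂ) (f : (V × F) → ℂ), avg ω M (c • f) = c • avg ω M f) ∧
    Set.BijOn (avg ω M) (HeisModel ω ψ L : Set ((V × F) → ℂ))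
      (HeisModel ω ψ M : Set ((V × F) → ℂ)) := by
  have h2 : (2 : F) ≠ 0 := by
    apply Ring.two_ne_zero
    intro h
    have := FiniteField.even_card_of_char_two h
    rw [Nat.odd_iff] at hq
    omega
  have hsup : L ⊔ M = ⊤ := by
    apply Submodule.eq_top_of_finrank_eq
    have := Submodule.finrank_sup_add_finrank_inf_eq L M
    rw [hLM, finrank_bot, hL.1, hM.1] at this
    omega
  have hA := avg_avg h2 ω halt hnd ψ hψadd hψ0 hψnt L M hM.2 hsup
  have hB := avg_avg h2 ω halt hnd ψ hψadd hψ0 hψnt M L hL.2 (by rw [sup_comm, hsup])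
  have cL : (Nat.card L : ℂ) ≠ 0 := by exact_mod_cast Nat.card_pos.ne'
  have cM : (Nat.card M : ℂ) ≠ 0 := by exact_mod_cast Nat.card_pos.ne'
  refine ⟨avg_mem ω ψ L M hM.2, fun h f _ => avg_rt ω M h f, avg_add ω M, avg_smul ω M,
    avg_mem ω ψ L M hM.2, ?_, ?_⟩
  · intro f hf g hg hfg
    have h1 := hA f hf
    rw [hfg, hA g hg] at h1
    exact (smul_right_injective _ cL h1).symm
  · intro g hg
    refine ⟨(Nat.card M : ℂ)⁻¹ • avg ω L g,
      Submodule.smul_mem _ _ (avg_mem ω ψ M L hL.2 g hg), ?_⟩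
    rw [avg_smul, hB g hg, smul_smul, inv_mul_cancel₀ cM, one_smul]

end Stmt6
end

section
/- For Lagrangian subspaces M, L ⊂ V, the linear transform I : ℂ(M\H/L, ψ) → Hom_H(𝓗_L, 𝓗_M) sending a kernel function K to the intertwiner I[K](f)(h') = Σ over the fibers of the multiplication map of K ⊠ f (i.e., convolution I[K](f) = K ∗ f) is surjective; moreover, if M ∩ L = 0 then I is injective, hence bijective. -/
namespace Stmt10

/-- Heisenberg multiplication on `V × F`: `(v,z)·(v',z') = (v+v', z+z'+½ω(v,v'))`. -/
def hmul {F V : Type} [Field F] [AddCommGroup V] [Module F V]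
    (ω : V →ₗ[F] V →ₗ[F] F) (a b : V × F) : V × F :=
  (a.1 + b.1, a.2 + b.2 + (2 : F)⁻¹ * ω a.1 b.1)

/-- A Lagrangian subspace: `n`-dimensional and `ω` vanishes identically on it. -/
def IsLagrangian {F V : Type} [Field F] [AddCommGroup V] [Module F V]
    (n : ℕ) (ω : V →ₗ[F] V →ₗ[F] F) (L : Submodule F V) : Prop :=
  Module.finrank F L = n ∧ ∀ x ∈ L, ∀ y ∈ L, ω x y = 0

/-- Right translation `(π(h)f)(h') = f(h'·h)`. -/
def rt {F V : Type} [Field F] [AddCommGroup V] [Module F V]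
    (ω : V →ₗ[F] V →ₗ[F] F) (h : V × F) (f : (V × F) → ℂ) : (V × F) → ℂ :=
  fun h' => f (hmul ω h' h)

/-- The model `𝓗_L = {f : H → ℂ | f((l,z)·h) = ψ(z)·f(h) for l ∈ L, z ∈ F}`,
as a complex subspace of the space of functions on the Heisenberg group. -/
noncomputable def HeisModel {F V : Type} [Field F] [AddCommGroup V] [Module F V]
    (ω : V →ₗ[F] V →ₗ[F] F) (ψ : F → ℂ) (L : Submodule F V) :
    Submodule ℂ ((V × F) → ℂ) where
  carrier := {f | ∀ l ∈ L, ∀ (z : F) (h : V × F), f (hmul ω (l, z) h) = ψ z * f h}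
  add_mem' := by
    intro f g hf hg l hl z h
    simp only [Pi.add_apply, hf l hl z h, hg l hl z h, mul_add]
  zero_mem' := by
    intro l hl z h
    simp
  smul_mem' := by
    intro c f hf l hl z h
    simp only [Pi.smul_apply, hf l hl z h, smul_eq_mul]
    ring

/-- The space `ℂ(M\H/L, ψ)` of kernel functions: `ψ`-equivariant under the center and
bi-invariant under `M` on the left and `L` on the right. -/
def KernelSpace {F V : Type} [Field F] [AddCommGroup V] [Module F V]
    (ω : V →ₗ[F] V →ₗ[F] F) (ψ : F → ℂ) (M L : Submodule F V) :
    Set ((V × F) → ℂ) :=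
  {K | (∀ (z : F) (h : V × F), K (hmul ω ((0 : V), z) h) = ψ z * K h) ∧
       (∀ m ∈ M, ∀ l ∈ L, ∀ h : V × F,
         K (hmul ω (hmul ω (m, (0 : F)) h) (l, (0 : F))) = K h)}

/-- Convolution over the subgroup `Z·M`:
`(K ∗ f)(h) = (1/|Z·M|) · Σ_{h₁·h₂ = h} K(h₁)·f(h₂)`. -/
noncomputable def conv {F V : Type} [Field F] [Fintype F] [AddCommGroup V] [Module F V]
    [Fintype V] (ω : V →ₗ[F] V →ₗ[F] F) (M : Submodule F V)
    (K f : (V × F) → ℂ) : (V × F) → ℂ :=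
  fun h => (Nat.card {x : V × F // x.1 ∈ M} : ℂ)⁻¹ *
    ∑ a : V × F, K a * f (hmul ω (-a.1, -a.2) h)


section helpers
variable {F V : Type} [Field F] [AddCommGroup V] [Module F V]

/-- Inverse in the Heisenberg group. -/
def hinv (a : V × F) : V × F := (-a.1, -a.2)

lemma hmul_assoc' (ω : V →ₗ[F] V →ₗ[F] F) (a b c : V × F) :
    hmul ω (hmul ω a b) c = hmul ω a (hmul ω b c) := by
  ext
  · simp [hmul, add_assoc]
  · simp [hmul]; ring

lemma hmul_zero' (ω : V →ₗ[F] V →ₗ[F] F) (a : V × F) : hmul ω a (0, 0) = a := by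
  ext <;> simp [hmul]

lemma zero_hmul' (ω : V →ₗ[F] V →ₗ[F] F) (a : V × F) : hmul ω (0, 0) a = a := by
  ext <;> simp [hmul]

lemma hmul_hinv (ω : V →ₗ[F] V →ₗ[F] F) (halt : ∀ v : V, ω v v = 0) (a : V × F) :
    hmul ω a (hinv a) = (0, 0) := by
  ext <;> simp [hmul, hinv, halt]

lemma hinv_hmul (ω : V →ₗ[F] V →ₗ[F] F) (halt : ∀ v : V, ω v v = 0) (a : V × F) :
    hmul ω (hinv a) a = (0, 0) := by
  ext <;> simp [hmul, hinv, halt]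

lemma hinv_hinv (a : V × F) : hinv (hinv a) = a := by
  ext <;> simp [hinv]

lemma hinv_mul_rev (ω : V →ₗ[F] V →ₗ[F] F) (halt : ∀ v : V, ω v v = 0) (a b : V × F) :
    hinv (hmul ω a b) = hmul ω (hinv b) (hinv a) := by
  have h : ω b.1 a.1 = - ω a.1 b.1 := by
    have := halt (a.1 + b.1)
    simp [halt] at this
    exact eq_neg_of_add_eq_zero_right this
  ext
  · simp [hmul, hinv, add_comm]
  · simp [hmul, hinv, h]; ring

/-- Left translation as an equivalence. -/
def eqL (ω : V →ₗ[F] V →ₗ[F] F) (halt : ∀ v : V, ω v v = 0) (g : V × F) :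
    (V × F) ≃ (V × F) where
  toFun a := hmul ω g a
  invFun a := hmul ω (hinv g) a
  left_inv a := by simp only [← hmul_assoc', hinv_hmul ω halt, zero_hmul']
  right_inv a := by simp only [← hmul_assoc', hmul_hinv ω halt, zero_hmul']

/-- `b ↦ g b⁻¹` as an equivalence. -/
def eqR (ω : V →ₗ[F] V →ₗ[F] F) (halt : ∀ v : V, ω v v = 0) (g : V × F) :
    (V × F) ≃ (V × F) where
  toFun b := hmul ω g (hinv b)
  invFun a := hmul ω (hinv a) g
  left_inv b := by
    simp only [hinv_mul_rev ω halt, hinv_hinv, hmul_assoc', hinv_hmul ω halt, hmul_zero']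
  right_inv a := by
    simp only [hinv_mul_rev ω halt, hinv_hinv, ← hmul_assoc', hmul_hinv ω halt, zero_hmul']

open Classical in
/-- The delta function of `𝓗_L`. -/
noncomputable def dl (ψ : F → ℂ) (L : Submodule F V) : (V × F) → ℂ :=
  fun h => if h.1 ∈ L then ψ h.2 else 0

lemma dl_mem (ω : V →ₗ[F] V →ₗ[F] F) (ψ : F → ℂ)
    (hψadd : ∀ a b : F, ψ (a + b) = ψ a * ψ b) (L : Submodule F V)
    (hL : ∀ x ∈ L, ∀ y ∈ L, ω x y = 0) : dl ψ L ∈ HeisModel ω ψ L := by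
  intro l hl z h
  by_cases hh : h.1 ∈ L
  · have : l + h.1 ∈ L := L.add_mem hl hh
    simp [dl, hmul, hh, this, hL l hl _ hh, hψadd]
  · have : l + h.1 ∉ L := fun h' => hh ((L.add_mem_iff_right hl).1 h')
    simp [dl, hmul, hh, this]

lemma rt_mem (ω : V →ₗ[F] V →ₗ[F] F) (ψ : F → ℂ) (L : Submodule F V) (g : V × F)
    (f : (V × F) → ℂ) (hf : f ∈ HeisModel ω ψ L) : rt ω g f ∈ HeisModel ω ψ L := by
  intro l hl z h
  simp only [rt, hmul_assoc']
  exact hf l hl z _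

lemma rt_dl (ω : V →ₗ[F] V →ₗ[F] F) (ψ : F → ℂ) (L : Submodule F V)
    (hL : ∀ x ∈ L, ∀ y ∈ L, ω x y = 0) (l : V) (hl : l ∈ L) :
    dl ψ L = rt ω (l, 0) (dl ψ L) := by
  funext h
  by_cases hh : h.1 ∈ L
  · have : h.1 + l ∈ L := L.add_mem hh hl
    simp [rt, dl, hmul, hh, this, hL _ hh _ hl]
  · have : h.1 + l ∉ L := fun h' => hh ((L.add_mem_iff_left hl).1 h')
    simp [rt, dl, hmul, hh, this]

lemma sum_ite_card [Fintype F] [Fintype V] (L : Submodule F V) (c : ℂ)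
    (g : V × F → ℂ) (h1 : ∀ b, b.1 ∈ L → g b = c) (h2 : ∀ b, b.1 ∉ L → g b = 0) :
    ∑ b, g b = (Nat.card {x : V × F // x.1 ∈ L} : ℂ) * c := by
  classical
  have : ∀ b, g b = if b.1 ∈ L then c else 0 := by
    intro b
    split_ifs with h
    · exact h1 b h
    · exact h2 b h
  simp only [this]
  rw [← Finset.sum_filter, Finset.sum_const, Nat.card_eq_fintype_card, Fintype.card_subtype,
    nsmul_eq_mul]

lemma card_ne [Fintype F] [Fintype V] (L : Submodule F V) :
    (Nat.card {x : V × F // x.1 ∈ L} : ℂ) ≠ 0 := by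
  have : Nonempty {x : V × F // x.1 ∈ L} := ⟨⟨(0, 0), L.zero_mem⟩⟩
  exact_mod_cast Nat.card_pos.ne'

lemma card_eq [Fintype F] [Fintype V] (L M : Submodule F V)
    (h : Module.finrank F L = Module.finrank F M) :
    Nat.card {x : V × F // x.1 ∈ L} = Nat.card {x : V × F // x.1 ∈ M} := by
  have e : L ≃ₗ[F] M := LinearEquiv.ofFinrankEq L M h
  have e1 : ∀ N : Submodule F V, Nonempty ({x : V × F // x.1 ∈ N} ≃ N × F) := fun N =>
    ⟨{ toFun := fun x => (⟨x.1.1, x.2⟩, x.1.2)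
       invFun := fun y => ⟨(y.1.1, y.2), y.1.2⟩
       left_inv := fun _ => rfl
       right_inv := fun _ => rfl }⟩
  obtain ⟨eL⟩ := e1 L
  obtain ⟨eM⟩ := e1 M
  exact Nat.card_congr (eL.trans ((e.toEquiv.prodCongr (Equiv.refl F)).trans eM.symm))

lemma psi_neg (ψ : F → ℂ) (hψadd : ∀ a b : F, ψ (a + b) = ψ a * ψ b) (hψ0 : ψ 0 = 1) (z : F) :
    ψ (-z) * ψ z = 1 := by
  rw [← hψadd]; simp [hψ0]

lemma ker_right (ω : V →ₗ[F] V →ₗ[F] F) (ψ : F → ℂ) (M L : Submodule F V)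
    (K : (V × F) → ℂ) (hK : K ∈ KernelSpace ω ψ M L) (h : V × F) (l : V) (hl : l ∈ L) (z : F) :
    K (hmul ω h (l, z)) = ψ z * K h := by
  have e : hmul ω h (l, z)
      = hmul ω (0, z) (hmul ω (hmul ω ((0 : V), (0 : F)) h) (l, 0)) := by
    ext <;> simp [hmul]; ring
  rw [e, hK.1, hK.2 0 M.zero_mem l hl]

lemma conv_dl [Fintype F] [Fintype V] (ω : V →ₗ[F] V →ₗ[F] F) (halt : ∀ v : V, ω v v = 0)
    (ψ : F → ℂ) (hψadd : ∀ a b : F, ψ (a + b) = ψ a * ψ b) (hψ0 : ψ 0 = 1)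
    (M L : Submodule F V) (h : Module.finrank F L = Module.finrank F M)
    (K : (V × F) → ℂ) (hK : K ∈ KernelSpace ω ψ M L) : conv ω M K (dl ψ L) = K := by
  funext g
  have : ∑ a : V × F, K a * dl ψ L (hmul ω (-a.1, -a.2) g)
      = (Nat.card {x : V × F // x.1 ∈ L} : ℂ) * K g := by
    rw [← (eqR ω halt g).sum_comp]
    have e : ∀ b, hmul ω (hinv (eqR ω halt g b)) g = b := (eqR ω halt g).left_inv
    apply sum_ite_card
    · intro b hb
      change _ * dl ψ L (hmul ω (hinv (eqR ω halt g b)) g) = _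
      rw [e]
      change K (hmul ω g (-b.1, -b.2)) * _ = _
      rw [ker_right ω ψ M L K hK g _ (L.neg_mem hb)]
      simp only [dl, hb, if_true]
      linear_combination K g * psi_neg ψ hψadd hψ0 b.2
    · intro b hb
      change _ * dl ψ L (hmul ω (hinv (eqR ω halt g b)) g) = _
      rw [e]
      simp [dl, hb]
  rw [conv, this, card_eq L M h, inv_mul_cancel_left₀ (card_ne M)]

lemma expand [Fintype F] [Fintype V] (ω : V →ₗ[F] V →ₗ[F] F) (halt : ∀ v : V, ω v v = 0)
    (ψ : F → ℂ) (hψadd : ∀ a b : F, ψ (a + b) = ψ a * ψ b) (hψ0 : ψ 0 = 1)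
    (L : Submodule F V) (f : (V × F) → ℂ) (hf : f ∈ HeisModel ω ψ L) (g : V × F) :
    ∑ a : V × F, f a * dl ψ L (hmul ω g (hinv a))
      = (Nat.card {x : V × F // x.1 ∈ L} : ℂ) * f g := by
  rw [← (eqR ω halt g).symm.sum_comp]
  have e : ∀ b, hmul ω g (hinv ((eqR ω halt g).symm b)) = b := (eqR ω halt g).right_inv
  apply sum_ite_card
  · intro b hb
    rw [e]
    change f (hmul ω (-b.1, -b.2) g) * _ = _
    rw [hf _ (L.neg_mem hb)]
    simp only [dl, hb, if_true]
    linear_combination f g * psi_neg ψ hψadd hψ0 b.2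
  · intro b hb
    rw [e]
    simp [dl, hb]

end helpers

/-- the kernel transform `I : ℂ(M\H/L, ψ) → Hom_H(𝓗_L, 𝓗_M)`,
`I[K](f) = K ∗ f`, is well defined (it lands in the intertwiners) and surjective;
moreover if `M ∩ L = 0` it is also injective, hence bijective. -/
theorem stmt_10 (n : ℕ) (F V : Type) [Field F] [Fintype F]
    (hq : Odd (Fintype.card F)) [AddCommGroup V] [Module F V] [Fintype V]
    (ω : V →ₗ[F] V →ₗ[F] F)
    (halt : ∀ v : V, ω v v = 0)
    (hnd : ∀ v : V, (∀ w : V, ω v w = 0) → v = 0)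
    (hdim : Module.finrank F V = 2 * n)
    (ψ : F → ℂ) (hψadd : ∀ a b : F, ψ (a + b) = ψ a * ψ b) (hψ0 : ψ 0 = 1)
    (hψnt : ∃ a : F, ψ a ≠ 1)
    (L M : Submodule F V) (hL : IsLagrangian n ω L) (hM : IsLagrangian n ω M) :
    (∀ K ∈ KernelSpace ω ψ M L, ∀ f ∈ HeisModel ω ψ L,
      conv ω M K f ∈ HeisModel ω ψ M ∧
      ∀ h : V × F, conv ω M K (rt ω h f) = rt ω h (conv ω M K f)) ∧
    (∀ T : (HeisModel ω ψ L) →ₗ[ℂ] (HeisModel ω ψ M),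
      (∀ (h : V × F) (f g : HeisModel ω ψ L),
        (g : (V × F) → ℂ) = rt ω h (f : (V × F) → ℂ) →
        (T g : (V × F) → ℂ) = rt ω h (T f : (V × F) → ℂ)) →
      ∃ K ∈ KernelSpace ω ψ M L,
        ∀ f : HeisModel ω ψ L, (T f : (V × F) → ℂ) = conv ω M K (f : (V × F) → ℂ)) ∧
    (M ⊓ L = ⊥ → ∀ K₁ ∈ KernelSpace ω ψ M L, ∀ K₂ ∈ KernelSpace ω ψ M L,
      (∀ f ∈ HeisModel ω ψ L, conv ω M K₁ f = conv ω M K₂ f) → K₁ = K₂) := by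
  have hfr : Module.finrank F L = Module.finrank F M := hL.1.trans hM.1.symm
  refine ⟨?_, ?_, ?_⟩
  · intro K hK f hf
    refine ⟨?_, ?_⟩
    · intro m hm z h
      have hKl : ∀ a, K (hmul ω (m, z) a) = ψ z * K a := by
        intro a
        have e : hmul ω (m, z) a
            = hmul ω (0, z) (hmul ω (hmul ω (m, (0 : F)) a) ((0 : V), (0 : F))) := by
          ext <;> simp [hmul]; ring
        rw [e, hK.1, hK.2 m hm 0 L.zero_mem]
      have : ∑ a : V × F, K a * f (hmul ω (-a.1, -a.2) (hmul ω (m, z) h))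
          = ψ z * ∑ a : V × F, K a * f (hmul ω (-a.1, -a.2) h) := by
        rw [← (eqL ω halt (m, z)).sum_comp, Finset.mul_sum]
        refine Finset.sum_congr rfl fun a _ => ?_
        change K (hmul ω (m, z) a) *
          f (hmul ω (hinv (hmul ω (m, z) a)) (hmul ω (m, z) h)) = ψ z * (K a * f (hmul ω (hinv a) h))
        rw [hKl, hinv_mul_rev ω halt, hmul_assoc', ← hmul_assoc' ω (hinv (m, z)),
          hinv_hmul ω halt, zero_hmul', mul_assoc]
      simp only [conv, this]
      ring
    · intro h
      funext g
      simp only [conv, rt, hmul_assoc']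
  · intro T hT
    let D : HeisModel ω ψ L := ⟨dl ψ L, dl_mem ω ψ hψadd L hL.2⟩
    let R : V × F → HeisModel ω ψ L := fun g => ⟨rt ω g (dl ψ L), rt_mem ω ψ L g _ D.2⟩
    refine ⟨(T D : (V × F) → ℂ), ⟨?_, ?_⟩, ?_⟩
    · intro z h
      exact (T D).2 0 M.zero_mem z h
    · intro m hm l hl h
      have h1 := hT (l, 0) D D (rt_dl ω ψ L hL.2 l hl)
      have h2 := congrFun h1 (hmul ω (m, 0) h)
      rw [rt] at h2
      rw [← h2, (T D).2 m hm 0 h, hψ0, one_mul]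
    · intro f
      have hf : (Nat.card {x : V × F // x.1 ∈ L} : ℂ) • f
          = ∑ a : V × F, (f : (V × F) → ℂ) a • R (hinv a) := by
        ext g
        have := expand ω halt ψ hψadd hψ0 L f f.2 g
        simp only [Submodule.coe_smul, AddSubmonoidClass.coe_finsetSum, Finset.sum_apply,
          Pi.smul_apply, smul_eq_mul]
        exact this.symm
      have h2 := congrArg T hf
      rw [map_smul, map_sum] at h2
      funext g
      have h3 := congrFun (congrArg Subtype.val h2) g
      simp only [map_smul, Submodule.coe_smul, AddSubmonoidClass.coe_finsetSum, Finset.sum_apply,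
          Pi.smul_apply, smul_eq_mul] at h3
      have h4 : ∀ a, (T (R a) : (V × F) → ℂ) g = (T D : (V × F) → ℂ) (hmul ω g a) := fun a =>
        congrFun (hT a D (R a) rfl) g
      simp only [h4] at h3
      rw [← (eqR ω halt g).symm.sum_comp] at h3
      have e : ∀ b, hmul ω g (hinv ((eqR ω halt g).symm b)) = b := (eqR ω halt g).right_inv
      simp only [e] at h3
      rw [conv, eq_inv_mul_iff_mul_eq₀ (card_ne M), ← card_eq L M hfr, h3]
      exact Finset.sum_congr rfl fun a _ => mul_comm _ _
  · intro _ K₁ h₁ K₂ h₂ h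
    rw [← conv_dl ω halt ψ hψadd hψ0 M L hfr K₁ h₁, ← conv_dl ω halt ψ hψadd hψ0 M L hfr K₂ h₂]
    exact h _ (dl_mem ω ψ hψadd L hL.2)


end Stmt10
end

section
/- (Existence of the linear Weil representation.) Fix a Lagrangian subspace L ⊂ V. There exists a group homomorphism ρ : Sp(V) → GL(𝓗_L) such that ρ(g) ∘ π_L(h) ∘ ρ(g)⁻¹ = π_L(g·h) for all g ∈ Sp(V) and h ∈ H, where g·(v,z) = (gv, z). In particular, the Weil representation of Sp(V) over 𝔽_q (q odd) is a genuine, not merely projective, representation. -/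
namespace Stmt15

/-- Heisenberg multiplication on `V × F`: `(v,z)·(v',z') = (v+v', z+z'+½ω(v,v'))`. -/
def hmul {F V : Type} [Field F] [AddCommGroup V] [Module F V]
    (ω : V →ₗ[F] V →ₗ[F] F) (a b : V × F) : V × F :=
  (a.1 + b.1, a.2 + b.2 + (2 : F)⁻¹ * ω a.1 b.1)

/-- A Lagrangian subspace: `n`-dimensional and `ω` vanishes identically on it. -/
def IsLagrangian {F V : Type} [Field F] [AddCommGroup V] [Module F V]
    (n : ℕ) (ω : V →ₗ[F] V →ₗ[F] F) (L : Submodule F V) : Prop :=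
  Module.finrank F L = n ∧ ∀ x ∈ L, ∀ y ∈ L, ω x y = 0

/-- Right translation `(π(h)f)(h') = f(h'·h)`. -/
def rt {F V : Type} [Field F] [AddCommGroup V] [Module F V]
    (ω : V →ₗ[F] V →ₗ[F] F) (h : V × F) (f : (V × F) → ℂ) : (V × F) → ℂ :=
  fun h' => f (hmul ω h' h)

/-- The model `𝓗_L = {f : H → ℂ | f((l,z)·h) = ψ(z)·f(h) for l ∈ L, z ∈ F}`,
as a complex subspace of the space of functions on the Heisenberg group. -/
noncomputable def HeisModel {F V : Type} [Field F] [AddCommGroup V] [Module F V]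
    (ω : V →ₗ[F] V →ₗ[F] F) (ψ : F → ℂ) (L : Submodule F V) :
    Submodule ℂ ((V × F) → ℂ) where
  carrier := {f | ∀ l ∈ L, ∀ (z : F) (h : V × F), f (hmul ω (l, z) h) = ψ z * f h}
  add_mem' := by
    intro f g hf hg l hl z h
    simp only [Pi.add_apply, hf l hl z h, hg l hl z h, mul_add]
  zero_mem' := by
    intro l hl z h
    simp
  smul_mem' := by
    intro c f hf l hl z h
    simp only [Pi.smul_apply, hf l hl z h, smul_eq_mul]
    ring


/-- The symplectic group `Sp(V)`: linear automorphisms of `V` preserving `ω`. -/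
def Sp (F V : Type) [Field F] [AddCommGroup V] [Module F V]
    (ω : V →ₗ[F] V →ₗ[F] F) : Subgroup (V ≃ₗ[F] V) where
  carrier := {g | ∀ v w : V, ω (g v) (g w) = ω v w}
  one_mem' := by intro v w; rfl
  mul_mem' := by
    intro a b ha hb v w
    exact (ha (b v) (b w)).trans (hb v w)
  inv_mem' := by
    intro a ha v w
    have h := ha (a.symm v) (a.symm w)
    have e : a⁻¹ = a.symm := rfl
    rw [e]
    simpa using h.symm


open Module

/-- Determinant ratio on the two eigenspaces of an involution of trace one. -/
theorem exists_normalizer {W : Type} [AddCommGroup W] [Module ℂ W] [FiniteDimensional ℂ W]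
    (ε : End ℂ W) (hε : ε * ε = 1) (htr : LinearMap.trace ℂ W ε = 1) :
    ∃ χ : End ℂ W → ℂ,
      (∀ A B, A * ε = ε * A → B * ε = ε * B → χ (A * B) = χ A * χ B) ∧
      (∀ c : ℂ, c ≠ 0 → χ (c • 1) = c⁻¹) := by
  classical
  let D : Submodule ℂ W → End ℂ W → ℂ := fun p A =>
    if h : ∀ x ∈ p, A x ∈ p then LinearMap.det (A.restrict h) else 0
  let Wp : Submodule ℂ W := LinearMap.ker (ε - 1)
  let Wm : Submodule ℂ W := LinearMap.ker (ε + 1)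
  have memp : ∀ x, x ∈ Wp ↔ ε x = x := by
    intro x; simp [Wp, sub_eq_zero]
  have memm : ∀ x, x ∈ Wm ↔ ε x = -x := by
    intro x; simp [Wm, add_eq_zero_iff_eq_neg]
  have hεε : ∀ x, ε (ε x) = x := fun x => by
    have := LinearMap.congr_fun hε x
    simpa using this
  have hD : ∀ p A B, (∀ x ∈ p, A x ∈ p) → (∀ x ∈ p, B x ∈ p) → D p (A * B) = D p A * D p B := by
    intro p A B hA hB
    have hAB : ∀ x ∈ p, (A * B) x ∈ p := fun x hx => hA _ (hB x hx)
    simp only [D, dif_pos hA, dif_pos hB, dif_pos hAB]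
    rw [← LinearMap.det_comp]
    rfl
  have hDc : ∀ (p : Submodule ℂ W) (c : ℂ), D p (c • 1) = c ^ finrank ℂ p := by
    intro p c
    have h : ∀ x ∈ p, (c • (1 : End ℂ W)) x ∈ p := fun x hx => by
      simpa using p.smul_mem c hx
    simp only [D, dif_pos h]
    rw [LinearMap.restrict_smul_one, LinearMap.det_smul]
    simp
  have cp : ∀ A : End ℂ W, A * ε = ε * A → ∀ x ∈ Wp, A x ∈ Wp := by
    intro A hA x hx
    rw [memp] at *
    have := LinearMap.congr_fun hA x
    simp only [End.mul_apply] at this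
    rw [← this, hx]
  have cm : ∀ A : End ℂ W, A * ε = ε * A → ∀ x ∈ Wm, A x ∈ Wm := by
    intro A hA x hx
    rw [memm] at *
    have := LinearMap.congr_fun hA x
    simp only [End.mul_apply] at this
    rw [← this, hx, map_neg]
  have pp : LinearMap.IsProj Wp ((2 : ℂ)⁻¹ • (1 + ε)) := by
    constructor
    · intro x
      rw [memp]
      simp [hεε, add_comm]
    · intro x hx
      rw [memp] at hx
      simp only [LinearMap.smul_apply, LinearMap.add_apply, End.one_apply, hx]
      rw [← two_smul ℂ x, smul_smul]; norm_num
  have pm : LinearMap.IsProj Wm ((2 : ℂ)⁻¹ • (1 - ε)) := by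
    constructor
    · intro x
      rw [memm]
      simp only [LinearMap.smul_apply, LinearMap.sub_apply, End.one_apply, map_smul, map_sub, hεε]
      rw [← smul_neg, neg_sub]
    · intro x hx
      rw [memm] at hx
      simp only [LinearMap.smul_apply, LinearMap.sub_apply, End.one_apply, hx, sub_neg_eq_add]
      rw [← two_smul ℂ x, smul_smul]; norm_num
  have tp := pp.trace
  have tm := pm.trace
  simp only [map_smul, map_add, map_sub, htr, smul_eq_mul] at tp tm
  have hd : finrank ℂ Wp = finrank ℂ Wm + 1 := by
    have : (finrank ℂ Wp : ℂ) = finrank ℂ Wm + 1 := by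
      rw [← tp, ← tm]; ring
    exact_mod_cast this
  refine ⟨fun A => D Wm A / D Wp A, ?_, ?_⟩
  · intro A B hA hB
    simp only [hD _ _ _ (cp A hA) (cp B hB), hD _ _ _ (cm A hA) (cm B hB)]
    rw [mul_div_mul_comm]
  · intro c hc
    simp only [hDc, hd]
    field_simp
    rw [pow_succ]

theorem abstract_weil {F V W : Type} [Field F] [AddCommGroup V] [Module F V] [Fintype V]
    (ω : V →ₗ[F] V →ₗ[F] F)
    (halt : ∀ v : V, ω v v = 0)
    (hnd : ∀ v : V, (∀ w : V, ω v w = 0) → v = 0)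
    (h2 : (2 : F) ≠ 0)
    (ψ : F → ℂ) (hψadd : ∀ a b : F, ψ (a + b) = ψ a * ψ b) (hψ0 : ψ 0 = 1)
    (hψnt : ∃ a : F, ψ a ≠ 1)
    [AddCommGroup W] [Module ℂ W] [FiniteDimensional ℂ W]
    (π : V → End ℂ W) (π0 : π 0 = 1)
    (πmul : ∀ v w, π v * π w = ψ ((2 : F)⁻¹ * ω v w) • π (v + w))
    (hpos : finrank ℂ W ≠ 0)
    (hcard : Fintype.card V = finrank ℂ W * finrank ℂ W)
    (ε : End ℂ W) (hε : ε * ε = 1) (hεπ : ∀ v, ε * π v = π (-v) * ε)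
    (htr : LinearMap.trace ℂ W ε = 1) :
    ∃ ρ : Sp F V ω →* (W ≃ₗ[ℂ] W), ∀ (g : Sp F V ω) (v : V) (f : W),
      ρ g (π v f) = π ((g : V ≃ₗ[F] V) v) (ρ g f) := by
  classical
  have skew : ∀ v w, ω v w = - ω w v := by
    intro v w
    have := halt (v + w)
    simp only [map_add, LinearMap.add_apply, halt, zero_add, add_zero] at this
    linear_combination this
  have πinv : ∀ v, π v * π (-v) = 1 := by
    intro v; rw [πmul]; simp [halt, hψ0, π0]
  have πinv' : ∀ v, π (-v) * π v = 1 := by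
    intro v; rw [πmul]; simp [halt, hψ0, π0]
  have trz : ∀ v, v ≠ 0 → LinearMap.trace ℂ W (π v) = 0 := by
    intro v hv
    obtain ⟨a, ha⟩ := hψnt
    obtain ⟨w, hw⟩ : ∃ w, ω v w ≠ 0 := by
      by_contra h
      push Not at h
      exact hv (hnd v h)
    set w' : V := (-a / ω v w) • w
    have hw' : ω w' v = a := by
      rw [skew]; simp [w', hw]
    have key : π w' * π v * π (-w') = ψ a • π v := by
      rw [πmul, smul_mul_assoc, πmul, smul_smul, ← hψadd]
      congr 2
      · simp only [map_add, map_neg, LinearMap.add_apply, halt, skew v w', hw']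
        field_simp
        ring
      · abel
    have := congrArg (LinearMap.trace ℂ W) key
    rw [LinearMap.trace_mul_comm, ← mul_assoc, πinv', one_mul, map_smul, smul_eq_mul] at this
    have h3 : (ψ a - 1) * LinearMap.trace ℂ W (π v) = 0 := by linear_combination -this
    rcases mul_eq_zero.1 h3 with h | h
    · exact absurd (sub_eq_zero.1 h) ha
    · exact h
  have li : LinearIndependent ℂ π := by
    rw [Fintype.linearIndependent_iff]
    intro c hc w
    have := congrArg (fun T => LinearMap.trace ℂ W (T * π (-w))) hc
    simp only [Finset.sum_mul, map_sum, smul_mul_assoc, πmul, map_smul, zero_mul, map_zero] at this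
    rw [Finset.sum_eq_single w] at this
    · simpa [halt, hψ0, π0, hpos] using this
    · intro b _ hb
      rw [trz (b + -w)]
      · simp
      · rwa [← sub_eq_add_neg, sub_ne_zero]
    · simp
  let b : Basis V ℂ (End ℂ W) := basisOfLinearIndependentOfCardEqFinrank li
    (by rw [hcard, finrank_linearMap])
  have hb : ∀ v, b v = π v := fun v => by simp [b]
  -- existence
  have ex : ∀ g : Sp F V ω, ∃ A : W ≃ₗ[ℂ] W, ∀ v,
      (A : End ℂ W) * π v = π ((g : V ≃ₗ[F] V) v) * (A : End ℂ W) := by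
    intro g
    let l : End ℂ W ≃ₗ[ℂ] End ℂ W := b.equiv b (g : V ≃ₗ[F] V).toEquiv
    have hl : ∀ v, l (π v) = π ((g : V ≃ₗ[F] V) v) := by
      intro v
      rw [← hb, ← hb]
      simp [l]
    have l1 : l 1 = 1 := by rw [← π0, hl, map_zero]
    have lm : ∀ x y, l (x * y) = l x * l y := by
      have : (LinearMap.mul ℂ (End ℂ W)).compr₂ l.toLinearMap =
          (LinearMap.mul ℂ (End ℂ W)).compl₁₂ l.toLinearMap l.toLinearMap := by
        refine b.ext fun v => b.ext fun w => ?_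
        simp only [hb, LinearMap.compr₂_apply, LinearMap.compl₁₂_apply, LinearMap.mul_apply',
          LinearEquiv.coe_coe, πmul, map_smul, hl, map_add]
        rw [g.2 v w]
      intro x y
      exact LinearMap.congr_fun₂ this x y
    obtain ⟨T, hT⟩ := (AlgEquiv.ofLinearEquiv l l1 lm).eq_linearEquivConjAlgEquiv
    refine ⟨T, fun v => ?_⟩
    have := congrArg (fun e => e (π v)) hT
    simp only [AlgEquiv.ofLinearEquiv_apply, hl] at this
    rw [this]
    ext x
    simp [LinearEquiv.conjAlgEquiv_apply]
  -- Schur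
  have schur : ∀ T : End ℂ W, (∀ v, T * π v = π v * T) → ∃ c : ℂ, T = c • 1 := by
    intro T hT
    have hc : LinearMap.mulLeft ℂ T = LinearMap.mulRight ℂ T :=
      b.ext fun v => by simpa [hb] using hT v
    have : T ∈ Subalgebra.center ℂ (End ℂ W) := by
      rw [Subalgebra.mem_center_iff]
      intro x
      exact (LinearMap.congr_fun hc x).symm
    rw [Algebra.IsCentral.center_eq_bot, Algebra.mem_bot] at this
    obtain ⟨c, hc⟩ := this
    exact ⟨c, by rw [← hc, Algebra.algebraMap_eq_smul_one]⟩
  choose A hA using ex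
  let B : Sp F V ω → End ℂ W := fun g => (A g : End ℂ W)
  let C : Sp F V ω → End ℂ W := fun g => ((A g).symm : End ℂ W)
  have BC : ∀ g, B g * C g = 1 := fun g => by ext x; simp [B, C]
  have CB : ∀ g, C g * B g = 1 := fun g => by ext x; simp [B, C]
  have hB : ∀ g v, B g * π v = π ((g : V ≃ₗ[F] V) v) * B g := hA
  -- two intertwiners differ by a scalar
  have uniq : ∀ (g : Sp F V ω) (T : End ℂ W), (∀ v, T * π v = π ((g : V ≃ₗ[F] V) v) * T) →
      ∃ c : ℂ, T = c • B g := by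
    intro g T hT
    obtain ⟨c, hc⟩ := schur (C g * T) (by
      intro v
      have : π v * C g = C g * π ((g : V ≃ₗ[F] V) v) := by
        calc π v * C g = (C g * B g) * π v * C g := by rw [CB, one_mul]
          _ = C g * (B g * π v) * C g := by simp only [mul_assoc]
          _ = C g * (π ((g : V ≃ₗ[F] V) v)) * (B g * C g) := by rw [hB]; simp only [mul_assoc]
          _ = _ := by rw [BC, mul_one]
      rw [mul_assoc, hT, ← mul_assoc, ← this, mul_assoc])
    refine ⟨c, ?_⟩
    calc T = B g * C g * T := by rw [BC, one_mul]
      _ = B g * (c • 1) := by rw [mul_assoc, hc]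
      _ = _ := by simp
  have one_ne : (1 : End ℂ W) ≠ 0 := by
    intro h
    have := congrArg (LinearMap.trace ℂ W) h
    simp [hpos] at this
  have hBε : ∀ g, B g * ε = ε * B g := by
    intro g
    have h1 : ∀ v, (ε * B g * ε) * π v = π ((g : V ≃ₗ[F] V) v) * (ε * B g * ε) := by
      intro v
      calc (ε * B g * ε) * π v = ε * (B g * π (-v)) * ε := by
            simp only [mul_assoc, hεπ]
        _ = (ε * π (-((g : V ≃ₗ[F] V) v))) * B g * ε := by rw [hB]; simp only [mul_assoc, map_neg]
        _ = _ := by rw [hεπ, neg_neg]; simp only [mul_assoc]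
    obtain ⟨c, hc⟩ := uniq g _ h1
    have h2 : B g * ε * C g = c • ε := by
      calc B g * ε * C g = (ε * ε) * B g * ε * C g := by rw [hε, one_mul]
        _ = ε * (ε * B g * ε) * C g := by simp only [mul_assoc]
        _ = c • (ε * (B g * C g)) := by rw [hc]; simp [mul_assoc]
        _ = c • ε := by rw [BC, mul_one]
    have h3 := congrArg (LinearMap.trace ℂ W) h2
    rw [LinearMap.trace_mul_comm, ← mul_assoc, CB, one_mul, map_smul, htr, smul_eq_mul, mul_one] at h3
    rw [← h3, one_smul] at hc
    calc B g * ε = (ε * ε) * B g * ε := by rw [hε, one_mul]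
      _ = ε * (ε * B g * ε) := by simp only [mul_assoc]
      _ = _ := by rw [hc]
  obtain ⟨χ, χmul, χc⟩ := exists_normalizer ε hε htr
  have cε : ∀ c : ℂ, (c • (1 : End ℂ W)) * ε = ε * (c • 1) := fun c => by simp
  have χsmul : ∀ (c : ℂ) (T : End ℂ W), c ≠ 0 → T * ε = ε * T →
      χ (c • T) • (c • T) = χ T • T := by
    intro c T hc hT
    have : c • T = (c • 1) * T := by simp
    rw [this, χmul _ _ (cε c) hT, χc c hc, ← this, smul_smul]
    congr 1
    field_simp
  let R : Sp F V ω →* End ℂ W :=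
    { toFun := fun g => χ (B g) • B g
      map_one' := by
        obtain ⟨c, hc⟩ := uniq 1 1 (fun v => by simp)
        have c0 : c ≠ 0 := by
          rintro rfl
          exact one_ne (by simpa using hc)
        rw [← χsmul c _ c0 (hBε 1), ← hc]
        have := χc 1 one_ne_zero
        rw [one_smul] at this
        rw [this]; simp
      map_mul' := by
        intro g h
        obtain ⟨c, hc⟩ := uniq (g * h) (B g * B h) (fun v => by
          rw [mul_assoc, hB, ← mul_assoc, hB, mul_assoc]; rfl)
        have c0 : c ≠ 0 := by
          rintro rfl
          rw [zero_smul] at hc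
          apply one_ne
          calc (1 : End ℂ W) = C h * (C g * (B g * B h)) := by
                rw [← mul_assoc (C g), CB, one_mul, CB]
            _ = 0 := by rw [hc]; simp
        rw [← χsmul c _ c0 (hBε (g * h)), ← hc, χmul _ _ (hBε g) (hBε h)]
        simp [smul_smul, mul_comm] }
  refine ⟨(LinearMap.GeneralLinearGroup.generalLinearEquiv ℂ W).toMonoidHom.comp R.toHomUnits, ?_⟩
  intro g v f
  change (χ (B g) • B g) (π v f) = π _ ((χ (B g) • B g) f)
  have := LinearMap.congr_fun (hB g v) f
  simp only [End.mul_apply] at this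
  simp [this]

/-- existence of the linear Weil representation: there is a group
homomorphism `ρ : Sp(V) → GL(𝓗_L)` such that `ρ(g) ∘ π_L(h) ∘ ρ(g)⁻¹ = π_L(g·h)`;
in particular the Weil representation over a finite field of odd characteristic is a
genuine (not merely projective) representation of `Sp(V)`. -/
theorem stmt_15 (n : ℕ) (F V : Type) [Field F] [Fintype F]
    (hq : Odd (Fintype.card F)) [AddCommGroup V] [Module F V] [Fintype V]
    (ω : V →ₗ[F] V →ₗ[F] F)
    (halt : ∀ v : V, ω v v = 0)
    (hnd : ∀ v : V, (∀ w : V, ω v w = 0) → v = 0)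
    (hdim : Module.finrank F V = 2 * n)
    (ψ : F → ℂ) (hψadd : ∀ a b : F, ψ (a + b) = ψ a * ψ b) (hψ0 : ψ 0 = 1)
    (hψnt : ∃ a : F, ψ a ≠ 1)
    (L : Submodule F V) (hL : IsLagrangian n ω L) :
    ∃ ρ : Sp F V ω →* ((HeisModel ω ψ L) ≃ₗ[ℂ] (HeisModel ω ψ L)),
      ∀ (g : Sp F V ω) (h : V × F) (f f' : HeisModel ω ψ L),
        (f' : (V × F) → ℂ) = rt ω h (f : (V × F) → ℂ) →
        (ρ g f' : (V × F) → ℂ) =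
          rt ω (((g : V ≃ₗ[F] V) h.1 : V), h.2) (ρ g f : (V × F) → ℂ) := by
  classical
  have skew : ∀ v w, ω v w = - ω w v := by
    intro v w
    have := halt (v + w)
    simp only [map_add, LinearMap.add_apply, halt, zero_add, add_zero] at this
    linear_combination this
  have h2 : (2 : F) ≠ 0 := by
    apply Ring.two_ne_zero
    intro h
    have := FiniteField.even_card_iff_char_two.1 h
    rw [Nat.odd_iff] at hq
    omega
  obtain ⟨hLn, hLiso⟩ := hL
  obtain ⟨M, hLM⟩ := Submodule.exists_isCompl L
  let P : V →ₗ[F] M := M.projectionOnto L hLM.symm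
  have PM : ∀ m : M, P m = m := fun m => Submodule.projectionOnto_apply_left hLM.symm m
  have PL : ∀ l ∈ L, P l = 0 := fun l hl =>
    (Submodule.projectionOnto_apply_eq_zero_iff hLM.symm).2 hl
  have subL : ∀ v, v - (P v : V) ∈ L := fun v => by
    rw [← Submodule.projectionOnto_apply_eq_zero_iff hLM.symm]
    change P _ = 0
    rw [map_sub, PM, sub_self]
  -- central action
  have cen : ∀ (f : HeisModel ω ψ L) (v : V) (z : F), (f : V × F → ℂ) (v, z) =
      ψ z * (f : V × F → ℂ) (v, 0) := by
    intro f v z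
    have := f.2 0 L.zero_mem z (v, 0)
    simpa [hmul] using this
  let e : HeisModel ω ψ L ≃ₗ[ℂ] (M → ℂ) :=
    { toFun := fun f m => (f : V × F → ℂ) (m, 0)
      map_add' := fun f g => rfl
      map_smul' := fun c f => rfl
      invFun := fun φ => ⟨fun x => ψ (x.2 - (2 : F)⁻¹ * ω x.1 (P x.1)) * φ (P x.1), by
        intro l hl z h
        have h1 : P (l + h.1) = P h.1 := by rw [map_add, PL l hl, zero_add]
        simp only [hmul, h1]
        rw [← mul_assoc, ← hψadd]
        congr 2
        have h3 : ω l (h.1 - P h.1) = 0 := hLiso l hl _ (subL _)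
        simp only [map_sub] at h3
        simp only [map_add, LinearMap.add_apply]
        linear_combination (2 : F)⁻¹ * h3⟩
      left_inv := by
        intro f
        ext ⟨v, z⟩
        have := f.2 (v - P v) (subL v) (z - (2 : F)⁻¹ * ω v (P v)) (P v, 0)
        simp only [hmul] at this ⊢
        rw [← this]
        simp [halt]
      right_inv := by
        intro φ
        ext m
        simp [PM, halt, hψ0] }
  have : FiniteDimensional ℂ (HeisModel ω ψ L) := FiniteDimensional.of_injective e.toLinearMap e.injective
  have hfin : finrank ℂ (HeisModel ω ψ L) = Fintype.card M := by
    rw [e.finrank_eq, finrank_fintype_fun_eq_card]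
  have hpos : finrank ℂ (HeisModel ω ψ L) ≠ 0 := by
    rw [hfin]; exact Fintype.card_ne_zero
  have hMn : finrank F M = n := by
    have := Submodule.finrank_add_eq_of_isCompl hLM
    omega
  have hcard : Fintype.card V = finrank ℂ (HeisModel ω ψ L) * finrank ℂ (HeisModel ω ψ L) := by
    rw [hfin, Module.card_eq_pow_finrank (K := F) (V := V),
      Module.card_eq_pow_finrank (K := F) (V := M), hdim, hMn, ← pow_add, two_mul]
  have rtmem : ∀ (v : V) (f : HeisModel ω ψ L),
      rt ω (v, 0) (f : V × F → ℂ) ∈ HeisModel ω ψ L := by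
    intro v f l hl z h
    have := f.2 l hl z (hmul ω h (v, 0))
    simp only [rt]
    rw [← this]
    refine congrArg f.1 (Prod.ext ?_ ?_)
    · simp [hmul, add_assoc]
    · simp [hmul]; ring
  let π : V → End ℂ (HeisModel ω ψ L) := fun v =>
    { toFun := fun f => ⟨rt ω (v, 0) f, rtmem v f⟩
      map_add' := fun f g => rfl
      map_smul' := fun c f => rfl }
  have πa : ∀ v f x, ((π v f : HeisModel ω ψ L) : V × F → ℂ) x =
      (f : V × F → ℂ) (hmul ω x (v, 0)) := fun v f x => rfl
  have π0 : π 0 = 1 := by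
    refine LinearMap.ext fun f => Subtype.ext (funext fun x => ?_)
    rw [πa]
    simp [hmul]
  have πmul : ∀ v w, π v * π w = ψ ((2 : F)⁻¹ * ω v w) • π (v + w) := by
    intro v w
    refine LinearMap.ext fun f => Subtype.ext (funext fun ⟨u, z⟩ => ?_)
    simp only [πa, End.mul_apply, hmul, LinearMap.smul_apply,
      Submodule.coe_smul, Pi.smul_apply, smul_eq_mul]
    rw [cen, cen f (u + (v + w)), ← mul_assoc, ← hψadd, add_assoc u]
    congr 2
    simp only [map_add, LinearMap.add_apply]
    ring
  let ε : End ℂ (HeisModel ω ψ L) :=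
    { toFun := fun f => ⟨fun x => (f : V × F → ℂ) (-x.1, x.2), by
        intro l hl z h
        have := f.2 (-l) (L.neg_mem hl) z (-h.1, h.2)
        rw [← this]
        simp [hmul, add_comm]⟩
      map_add' := fun f g => rfl
      map_smul' := fun c f => rfl }
  have εa : ∀ f x, ((ε f : HeisModel ω ψ L) : V × F → ℂ) x =
      (f : V × F → ℂ) (-x.1, x.2) := fun f x => rfl
  have hε : ε * ε = 1 := by
    refine LinearMap.ext fun f => Subtype.ext (funext fun x => ?_)
    simp [εa]
  have hεπ : ∀ v, ε * π v = π (-v) * ε := by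
    intro v
    refine LinearMap.ext fun f => Subtype.ext (funext fun ⟨u, z⟩ => ?_)
    simp [εa, πa, hmul, add_comm]
  have htr : LinearMap.trace ℂ (HeisModel ω ψ L) ε = 1 := by
    rw [← LinearMap.trace_conj' ε e, LinearMap.trace_eq_matrix_trace ℂ (Pi.basisFun ℂ M),
      Matrix.trace]
    have hconj : e.conj ε = LinearMap.funLeft ℂ ℂ (fun m : M => -m) := by
      rw [LinearEquiv.conj_apply]
      refine LinearMap.ext fun φ => ?_
      obtain ⟨f, rfl⟩ := e.surjective φ
      simp only [LinearMap.comp_apply, LinearEquiv.coe_coe, LinearEquiv.symm_apply_apply]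
      ext m
      change ((ε f : HeisModel ω ψ L) : V × F → ℂ) (m, 0) = (f : V × F → ℂ) (((-m : M) : V), 0)
      simp [εa]
    rw [hconj, Finset.sum_eq_single (0 : M)]
    · simp [LinearMap.toMatrix_apply, LinearMap.funLeft]
    · intro m _ hm
      simp only [Matrix.diag_apply, LinearMap.toMatrix_apply, Pi.basisFun_apply,
        Pi.basisFun_repr, LinearMap.funLeft_apply]
      rw [Pi.single_apply, if_neg]
      intro h
      apply hm
      have h4 : (2 : F) • m = 0 := by
        rw [two_smul]; nth_rewrite 1 [← h]; simp
      exact (smul_eq_zero.1 h4).resolve_left h2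
    · simp
  obtain ⟨ρ, hρ⟩ := abstract_weil ω halt hnd h2 ψ hψadd hψ0 hψnt π π0 πmul hpos hcard ε hε hεπ htr
  have rtz : ∀ (v : V) (z : F) (f : HeisModel ω ψ L),
      rt ω (v, z) (f : V × F → ℂ) = ((ψ z • π v f : HeisModel ω ψ L) : V × F → ℂ) := by
    intro v z f
    ext ⟨u, y⟩
    simp only [rt, hmul, πa, Submodule.coe_smul, Pi.smul_apply,
      smul_eq_mul]
    rw [cen, cen f (u + v) (y + 0 + _), ← mul_assoc, ← hψadd]
    congr 2
    ring
  refine ⟨ρ, ?_⟩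
  intro g h f f' hf
  have h5 : f' = ψ h.2 • π h.1 f := by
    apply Subtype.ext
    rw [hf, ← rtz]
  rw [h5, map_smul, hρ, rtz]

end Stmt15
end

section
/- (Compatibility with symplectic reduction, dimension form.) Let L ⊂ V be a Lagrangian subspace and let I ⊂ V be an isotropic subspace of dimension d (ω vanishes identically on I × I). Then the subspace of I-invariant vectors 𝓗_L^I = {f ∈ 𝓗_L : π_L((i,0))f = f for all i ∈ I} has dimension q^{n−d} over ℂ; equivalently, dim 𝓗_L^I equals the dimension of the Heisenberg representation of the symplectic reduction I^⊥/I, where I^⊥ = {v ∈ V : ω(v,i) = 0 for all i ∈ I}. -/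
namespace Stmt18

/-- Heisenberg multiplication on `V × F`: `(v,z)·(v',z') = (v+v', z+z'+½ω(v,v'))`. -/
def hmul {F V : Type} [Field F] [AddCommGroup V] [Module F V]
    (ω : V →ₗ[F] V →ₗ[F] F) (a b : V × F) : V × F :=
  (a.1 + b.1, a.2 + b.2 + (2 : F)⁻¹ * ω a.1 b.1)

/-- A Lagrangian subspace: `n`-dimensional and `ω` vanishes identically on it. -/
def IsLagrangian {F V : Type} [Field F] [AddCommGroup V] [Module F V]
    (n : ℕ) (ω : V →ₗ[F] V →ₗ[F] F) (L : Submodule F V) : Prop :=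
  Module.finrank F L = n ∧ ∀ x ∈ L, ∀ y ∈ L, ω x y = 0

/-- Right translation `(π(h)f)(h') = f(h'·h)`. -/
def rt {F V : Type} [Field F] [AddCommGroup V] [Module F V]
    (ω : V →ₗ[F] V →ₗ[F] F) (h : V × F) (f : (V × F) → ℂ) : (V × F) → ℂ :=
  fun h' => f (hmul ω h' h)

/-- The model `𝓗_L = {f : H → ℂ | f((l,z)·h) = ψ(z)·f(h) for l ∈ L, z ∈ F}`,
as a complex subspace of the space of functions on the Heisenberg group. -/
noncomputable def HeisModel {F V : Type} [Field F] [AddCommGroup V] [Module F V]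
    (ω : V →ₗ[F] V →ₗ[F] F) (ψ : F → ℂ) (L : Submodule F V) :
    Submodule ℂ ((V × F) → ℂ) where
  carrier := {f | ∀ l ∈ L, ∀ (z : F) (h : V × F), f (hmul ω (l, z) h) = ψ z * f h}
  add_mem' := by
    intro f g hf hg l hl z h
    simp only [Pi.add_apply, hf l hl z h, hg l hl z h, mul_add]
  zero_mem' := by
    intro l hl z h
    simp
  smul_mem' := by
    intro c f hf l hl z h
    simp only [Pi.smul_apply, hf l hl z h, smul_eq_mul]
    ring


/-- The subspace `𝓗_L^I` of `I`-invariant vectors in the model `𝓗_L`. -/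
noncomputable def InvModel {F V : Type} [Field F] [AddCommGroup V] [Module F V]
    (ω : V →ₗ[F] V →ₗ[F] F) (ψ : F → ℂ) (L I : Submodule F V) :
    Submodule ℂ ((V × F) → ℂ) where
  carrier := {f | f ∈ HeisModel ω ψ L ∧ ∀ i ∈ I, rt ω (i, (0 : F)) f = f}
  add_mem' := by
    rintro f g ⟨hf1, hf2⟩ ⟨hg1, hg2⟩
    refine ⟨(HeisModel ω ψ L).add_mem hf1 hg1, fun i hi => ?_⟩
    have h : rt ω (i, (0 : F)) (f + g) = rt ω (i, (0 : F)) f + rt ω (i, (0 : F)) g := rfl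
    rw [h, hf2 i hi, hg2 i hi]
  zero_mem' := ⟨(HeisModel ω ψ L).zero_mem, fun i hi => rfl⟩
  smul_mem' := by
    rintro c f ⟨hf1, hf2⟩
    refine ⟨(HeisModel ω ψ L).smul_mem c hf1, fun i hi => ?_⟩
    have h : rt ω (i, (0 : F)) (c • f) = c • rt ω (i, (0 : F)) f := rfl
    rw [h, hf2 i hi]

section Helpers

variable {F V : Type} [Field F] [AddCommGroup V] [Module F V]

theorem hmul_assoc (ω : V →ₗ[F] V →ₗ[F] F) (a b c : V × F) :
    hmul ω (hmul ω a b) c = hmul ω a (hmul ω b c) := by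
  ext
  · simp [hmul, add_assoc]
  · simp [hmul]; ring

open scoped Classical in
theorem charsum [Fintype V] (ω : V →ₗ[F] V →ₗ[F] F)
    (halt : ∀ v : V, ω v v = 0)
    (hnd : ∀ v : V, (∀ w : V, ω v w = 0) → v = 0)
    (ψ : F → ℂ) (hψadd : ∀ a b : F, ψ (a + b) = ψ a * ψ b) (hψ0 : ψ 0 = 1)
    (hψnt : ∃ a : F, ψ a ≠ 1) (i : V) :
    ∑ v, ψ (ω v i) = if i = 0 then (Fintype.card V : ℂ) else 0 := by
  split_ifs with h
  · simp [h, hψ0]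
  · have h1 : ∃ w, ω w i ≠ 0 := by
      by_contra! hc
      refine h (hnd i fun w => ?_)
      have := halt (i + w)
      simp [halt, hc] at this
      exact this
    obtain ⟨w, hw⟩ := h1
    obtain ⟨a, ha⟩ := hψnt
    have h2 : ∑ v, ψ (ω v i) = ψ a * ∑ v, ψ (ω v i) := by
      rw [Finset.mul_sum, ← Equiv.sum_comp (Equiv.addLeft ((a / ω w i) • w))]
      refine Finset.sum_congr rfl fun v _ => ?_
      simp [hψadd, hw]
    have h3 : (ψ a - 1) * ∑ v, ψ (ω v i) = 0 := by
      rw [sub_mul, ← h2]; ring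
    exact (mul_eq_zero.mp h3).resolve_left (sub_ne_zero.mpr ha)

open scoped Classical in
/-- Unnormalised averaging operator. -/
noncomputable def avg [Fintype F] [Fintype V] (ω : V →ₗ[F] V →ₗ[F] F) (ψ : F → ℂ)
    (L I : Submodule F V) : ((V × F) → ℂ) →ₗ[ℂ] ((V × F) → ℂ) where
  toFun f := fun h => ∑ p : L × F × I,
    ψ (-p.2.1) * f (hmul ω (hmul ω ((p.1 : V), p.2.1) h) ((p.2.2 : V), 0))
  map_add' f g := by
    funext h
    simp [mul_add, Finset.sum_add_distrib]
  map_smul' c f := by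
    funext h
    simp only [Pi.smul_apply, smul_eq_mul, RingHom.id_apply, Finset.mul_sum]
    exact Finset.sum_congr rfl fun _ _ => by ring

theorem avg_mem [Fintype F] [Fintype V] (ω : V →ₗ[F] V →ₗ[F] F) (ψ : F → ℂ)
    (hψadd : ∀ a b : F, ψ (a + b) = ψ a * ψ b)
    (L I : Submodule F V) (hL : ∀ x ∈ L, ∀ y ∈ L, ω x y = 0)
    (hIiso : ∀ x ∈ I, ∀ y ∈ I, ω x y = 0) (f : (V × F) → ℂ) :
    avg ω ψ L I f ∈ InvModel ω ψ L I := by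
  classical
  refine ⟨?_, ?_⟩
  · intro l hl z h
    simp only [avg, LinearMap.coe_mk, AddHom.coe_mk]
    rw [Finset.mul_sum, ← Equiv.sum_comp (Equiv.addRight ((⟨l, hl⟩ : L), z, (0 : I)))
      (fun p => ψ z * _)]
    refine Finset.sum_congr rfl fun p _ => ?_
    obtain ⟨p1, p2, p3⟩ := p
    have e : hmul ω ((p1 : V), p2) (hmul ω (l, z) h) = hmul ω ((p1 : V) + l, p2 + z) h := by
      rw [← hmul_assoc]
      simp [hmul, hL p1 p1.2 l hl]
    simp only [Equiv.coe_addRight, Prod.mk_add_mk, add_zero, Submodule.coe_add, e]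
    rw [← mul_assoc, ← hψadd]
    congr 2
    ring
  · intro i hi
    funext h
    simp only [avg, LinearMap.coe_mk, AddHom.coe_mk, rt]
    rw [← Equiv.sum_comp (Equiv.addLeft ((0 : L), (0 : F), (⟨i, hi⟩ : I)))
      (fun p => ψ (-p.2.1) * f (hmul ω (hmul ω ((p.1 : V), p.2.1) h) ((p.2.2 : V), 0)))]
    refine Finset.sum_congr rfl fun p _ => ?_
    obtain ⟨p1, p2, p3⟩ := p
    have e : hmul ω (hmul ω ((p1 : V), p2) (hmul ω h (i, 0))) ((p3 : V), 0)
        = hmul ω (hmul ω ((p1 : V), p2) h) (i + (p3 : V), 0) := by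
      rw [← hmul_assoc, hmul_assoc ω _ (i, 0)]
      congr 1
      simp [hmul, hIiso i hi p3 p3.2]
    simp only [Equiv.coe_addLeft, Prod.mk_add_mk, zero_add, Submodule.coe_add, e]

open scoped Classical in
theorem avg_id [Fintype F] [Fintype V] (ω : V →ₗ[F] V →ₗ[F] F) (ψ : F → ℂ)
    (hψadd : ∀ a b : F, ψ (a + b) = ψ a * ψ b) (hψ0 : ψ 0 = 1)
    (L I : Submodule F V) (f : (V × F) → ℂ) (hf : f ∈ InvModel ω ψ L I) :
    avg ω ψ L I f = (Fintype.card (L × F × I) : ℂ) • f := by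
  funext h
  simp only [avg, LinearMap.coe_mk, AddHom.coe_mk]
  have : ∀ p : L × F × I,
      ψ (-p.2.1) * f (hmul ω (hmul ω ((p.1 : V), p.2.1) h) ((p.2.2 : V), 0)) = f h := by
    intro p
    have h1 := congrFun (hf.2 p.2.2 p.2.2.2) (hmul ω ((p.1 : V), p.2.1) h)
    simp only [rt] at h1
    rw [h1, hf.1 p.1 p.1.2, ← mul_assoc, ← hψadd]
    simp [hψ0]
  simp only [this]
  rw [Finset.sum_const, Finset.card_univ, Pi.smul_apply, nsmul_eq_mul, smul_eq_mul]

theorem avg_trace [Fintype F] [Fintype V] (ω : V →ₗ[F] V →ₗ[F] F)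
    (h2 : (2 : F) ≠ 0)
    (halt : ∀ v : V, ω v v = 0)
    (hnd : ∀ v : V, (∀ w : V, ω v w = 0) → v = 0)
    (ψ : F → ℂ) (hψadd : ∀ a b : F, ψ (a + b) = ψ a * ψ b) (hψ0 : ψ 0 = 1)
    (hψnt : ∃ a : F, ψ a ≠ 1) (L I : Submodule F V) :
    LinearMap.trace ℂ _ (avg ω ψ L I) = (Fintype.card F : ℂ) * Fintype.card V := by
  classical
  have hskew : ∀ x y, ω x y = - ω y x := by
    intro x y
    have := halt (x + y)
    simp [halt] at this
    linear_combination this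
  rw [LinearMap.trace_eq_matrix_trace ℂ (Pi.basisFun ℂ (V × F))]
  simp only [Matrix.trace, Matrix.diag, LinearMap.toMatrix_apply, Pi.basisFun_apply,
    Pi.basisFun_repr, avg, LinearMap.coe_mk, AddHom.coe_mk]
  have key : ∀ (h : V × F) (p : L × F × I),
      ψ (-p.2.1) * (Pi.single h (1 : ℂ) : V × F → ℂ)
        (hmul ω (hmul ω ((p.1 : V), p.2.1) h) ((p.2.2 : V), 0))
      = if p.1 = (-p.2.2 : V) then (if p.2.1 = - ω h.1 p.2.2 then ψ (ω h.1 p.2.2) else 0)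
        else 0 := by
    rintro ⟨v, w⟩ ⟨l, z, i⟩
    rw [Pi.single_apply]
    by_cases hl : (l : V) = -(i : V)
    · have : hmul ω (hmul ω ((l : V), z) (v, w)) ((i : V), 0) = (v, w) ↔ z = - ω v i := by
        simp only [hmul, hl, Prod.mk.injEq, map_neg, map_add, LinearMap.neg_apply,
          LinearMap.add_apply, halt, hskew (i : V) v]
        constructor
        · rintro ⟨-, h⟩
          field_simp at h
          have h' : (2 : F) * (z + ω v i) = 0 := by linear_combination h
          linear_combination (mul_eq_zero.mp h').resolve_left h2
        · intro h
          refine ⟨by abel, ?_⟩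
          rw [h]
          field_simp
          ring
      rw [if_pos hl]
      simp only [this]
      split_ifs with hz
      · simp [hz]
      · simp
    · have : ¬ hmul ω (hmul ω ((l : V), z) (v, w)) ((i : V), 0) = (v, w) := by
        intro h
        apply hl
        have := congrArg Prod.fst h
        simp only [hmul] at this
        have h' : (l : V) + i = 0 := by
          have h'' : (l : V) + i + v = 0 + v := by
            rw [zero_add, add_right_comm]
            exact this
          exact add_right_cancel h''
        exact eq_neg_of_add_eq_zero_left h'
      simp [this, hl]
  simp only [key]
  rw [Finset.sum_comm]
  simp only [Fintype.sum_prod_type]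
  have s1 : ∀ (l : L) (i : I), ∑ z : F, ∑ v : V, ∑ w : F,
      (if (l : V) = -(i : V) then (if z = - ω v i then ψ (ω v i) else 0) else 0)
      = if i = 0 then (if l = 0 then (Fintype.card F : ℂ) * Fintype.card V else 0) else 0 := by
    intro l i
    by_cases hl : (l : V) = -(i : V)
    · simp only [hl, if_true]
      rw [Finset.sum_comm]
      simp only [Finset.sum_const, Finset.card_univ, ← Finset.smul_sum, Finset.sum_ite_eq',
        Finset.mem_univ, if_true]
      rw [charsum ω halt hnd ψ hψadd hψ0 hψnt]
      by_cases hi : i = 0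
      · have hl0 : l = 0 := by ext; simp [hl, hi]
        simp [hi, hl0]
      · simp [hi]
    · simp only [hl, if_false, Finset.sum_const_zero]
      split_ifs with h1 h3
      · exact absurd (by simp [h1, h3]) hl
      · rfl
      · rfl
  have s2 : ∀ l : L, ∑ z : F, ∑ i : I, ∑ v : V, ∑ w : F,
      (if (l : V) = -(i : V) then (if z = - ω v i then ψ (ω v i) else 0) else 0)
      = if l = 0 then (Fintype.card F : ℂ) * Fintype.card V else 0 := by
    intro l
    rw [Finset.sum_comm]
    simp only [s1]
    simp
  simp only [s2]
  simp

end Helpers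

/-- compatibility with symplectic reduction, dimension form: for a
Lagrangian `L` and an isotropic subspace `I` of dimension `d`, the space `𝓗_L^I` of
`I`-invariant vectors has dimension `q^{n−d}`, the dimension of the Heisenberg
representation of the symplectic reduction `I^⊥/I`. -/
theorem stmt_18 (n : ℕ) (F V : Type) [Field F] [Fintype F]
    (hq : Odd (Fintype.card F)) [AddCommGroup V] [Module F V] [Fintype V]
    (ω : V →ₗ[F] V →ₗ[F] F)
    (halt : ∀ v : V, ω v v = 0)
    (hnd : ∀ v : V, (∀ w : V, ω v w = 0) → v = 0)
    (hdim : Module.finrank F V = 2 * n)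
    (ψ : F → ℂ) (hψadd : ∀ a b : F, ψ (a + b) = ψ a * ψ b) (hψ0 : ψ 0 = 1)
    (hψnt : ∃ a : F, ψ a ≠ 1)
    (L : Submodule F V) (hL : IsLagrangian n ω L)
    (I : Submodule F V) (d : ℕ) (hId : Module.finrank F I = d)
    (hIiso : ∀ x ∈ I, ∀ y ∈ I, ω x y = 0) :
    Module.finrank ℂ (InvModel ω ψ L I) = Fintype.card F ^ (n - d) := by
  classical
  have h2 : (2 : F) ≠ 0 := by
    apply Ring.two_ne_zero
    intro h
    have := FiniteField.even_card_of_char_two h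
    rw [Nat.odd_iff] at hq
    omega
  obtain ⟨hLn, hLi⟩ := hL
  have hN : (Fintype.card (L × F × I) : ℂ) ≠ 0 := by
    exact_mod_cast Fintype.card_ne_zero
  have hproj : LinearMap.IsProj (InvModel ω ψ L I)
      ((Fintype.card (L × F × I) : ℂ)⁻¹ • avg ω ψ L I) := by
    refine ⟨fun f => ?_, fun f hf => ?_⟩
    · exact Submodule.smul_mem _ _ (avg_mem ω ψ hψadd L I hLi hIiso f)
    · rw [LinearMap.smul_apply, avg_id ω ψ hψadd hψ0 L I f hf, smul_smul, inv_mul_cancel₀ hN,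
        one_smul]
  have ht := hproj.trace
  rw [map_smul, avg_trace ω h2 halt hnd ψ hψadd hψ0 hψnt, smul_eq_mul,
    inv_mul_eq_iff_eq_mul₀ hN] at ht
  have ht' : Fintype.card F * Fintype.card V
      = Fintype.card (L × F × I) * Module.finrank ℂ (InvModel ω ψ L I) := by
    exact_mod_cast ht
  have hq1 : 1 < Fintype.card F := Fintype.one_lt_card
  have hV : Fintype.card V = Fintype.card F ^ (2 * n) := by
    rw [← hdim]; exact Module.card_eq_pow_finrank
  have hLc : Fintype.card L = Fintype.card F ^ n := by
    rw [← hLn]; exact Module.card_eq_pow_finrank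
  have hIc : Fintype.card I = Fintype.card F ^ d := by
    rw [← hId]; exact Module.card_eq_pow_finrank
  rw [Fintype.card_prod, Fintype.card_prod, hV, hLc, hIc] at ht'
  generalize Module.finrank ℂ (InvModel ω ψ L I) = m at ht' ⊢
  generalize Fintype.card F = q at ht' hq1 ⊢
  have hq0 : 0 < q := by omega
  have h3 : q ^ n = q ^ d * m := by
    have : (q * q ^ n) * q ^ n = (q * q ^ n) * (q ^ d * m) := by
      rw [two_mul, pow_add] at ht'
      linear_combination ht'
    exact Nat.eq_of_mul_eq_mul_left (by positivity) this
  have hdn : d ≤ n := (Nat.pow_dvd_pow_iff_le_right hq1).mp ⟨m, h3⟩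
  have h4 : q ^ d * q ^ (n - d) = q ^ d * m := by
    rw [← pow_add, Nat.add_sub_cancel' hdn, h3]
  exact (Nat.eq_of_mul_eq_mul_left (by positivity) h4).symm

end Stmt18
end
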